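/- arXiv:2412.05470 — 5 statements merged into one kernel-verified Lean document; each statement's English description precedes it below -/
import Mathlib

section
/- Let n ≥ 2 be an integer and let ν_1, …, ν_n be positive integers such that gcd(ν_j, ν_{j+1}) = 1 for all 1 ≤ j ≤ n−1, and such that ν_j divides ν_{j−1} + ν_{j+1} for all 2 ≤ j ≤ n−1. Then, in the polynomial ring ℤ[T], the product ∏_{j=2}^{n−1} (T^{ν_j} − 1) divides the polynomial Σ_{j=1}^{n−1} ∏_{k ∈ {1,…,n} \ {j, j+1}} (T^{ν_k} − 1) + Σ_{j=2}^{n−1} ∏_{k ∈ {1,…,n} \ {j}} (T^{ν_k} − 1). -/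
open Polynomial

section GeomSum

variable {R : Type*} [CommRing R]

theorem geom_sum_add (x : R) (a b : ℕ) :
    ∑ i ∈ Finset.range (a + b), x ^ i =
      ∑ i ∈ Finset.range a, x ^ i + x ^ a * ∑ i ∈ Finset.range b, x ^ i := by
  simp only [Finset.sum_range_add, Finset.mul_sum, pow_add]

theorem geom_sum_dvd_geom_sum (x : R) {a b : ℕ} (h : a ∣ b) :
    ∑ i ∈ Finset.range a, x ^ i ∣ ∑ i ∈ Finset.range b, x ^ i := by
  obtain ⟨c, rfl⟩ := h
  induction c with
  | zero => simp
  | succ c ih =>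
    rw [Nat.mul_succ, geom_sum_add]
    exact dvd_add ih (dvd_mul_left _ _)

theorem isCoprime_geom_sum (x : R) {a b : ℕ} (h : Nat.Coprime a b) :
    IsCoprime (∑ i ∈ Finset.range a, x ^ i) (∑ i ∈ Finset.range b, x ^ i) := by
  induction hs : a + b using Nat.strong_induction_on generalizing a b with
  | _ s ih =>
    wlog hab : a ≤ b generalizing a b
    · exact (this h.symm (by omega) (by omega)).symm
    rcases Nat.eq_zero_or_pos a with rfl | ha
    · obtain rfl : b = 1 := by simpa using h
      simpa using isCoprime_one_right
    obtain ⟨c, rfl⟩ := Nat.exists_eq_add_of_le hab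
    have hc := ih (a + c) (by omega) (a := a) (b := c) (by simpa using h) rfl
    have key : ∑ i ∈ Finset.range (a + c), x ^ i = ∑ i ∈ Finset.range c, x ^ i +
        (∑ i ∈ Finset.range a, x ^ i) * (1 + (x - 1) * ∑ i ∈ Finset.range c, x ^ i) := by
      rw [geom_sum_add]
      linear_combination (-∑ i ∈ Finset.range c, x ^ i) * geom_sum_mul x a
    rw [key]
    exact hc.add_mul_left_right _

end GeomSum

/-- Adjoining one more index to the numerator, in terms of arbitrary factors `P k`. -/
theorem numerator_succ {R : Type*} [CommRing R] (P : ℕ → R) {n : ℕ} (hn : 2 ≤ n) :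
    (∑ j ∈ Finset.Icc 1 n, ∏ k ∈ Finset.Icc 1 (n + 1) \ {j, j + 1}, P k)
        + ∑ j ∈ Finset.Icc 2 n, ∏ k ∈ Finset.Icc 1 (n + 1) \ {j}, P k =
      P (n + 1) * ((∑ j ∈ Finset.Icc 1 (n - 1), ∏ k ∈ Finset.Icc 1 n \ {j, j + 1}, P k)
        + ∑ j ∈ Finset.Icc 2 (n - 1), ∏ k ∈ Finset.Icc 1 n \ {j}, P k)
        + P 1 * (∏ k ∈ Finset.Icc 2 (n - 1), P k) * (1 + P (n + 1)) := by
  obtain ⟨m, rfl⟩ : ∃ m, n = m + 1 := ⟨n - 1, by omega⟩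
  have hfirst : ∏ k ∈ Finset.Icc 1 m, P k = P 1 * ∏ k ∈ Finset.Icc 2 m, P k := by
    rw [← Finset.prod_insert (by simp)]
    congr 1
    ext k
    simp only [Finset.mem_Icc, Finset.mem_insert]
    omega
  have hpair : ∀ j ∈ Finset.Icc 1 m, ∏ k ∈ Finset.Icc 1 (m + 1 + 1) \ {j, j + 1}, P k =
      P (m + 1 + 1) * ∏ k ∈ Finset.Icc 1 (m + 1) \ {j, j + 1}, P k := by
    intro j hj
    rw [Finset.mem_Icc] at hj
    rw [← Finset.prod_insert (by simp)]
    congr 1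
    ext k
    simp only [Finset.mem_Icc, Finset.mem_insert, Finset.mem_sdiff, Finset.mem_singleton]
    omega
  have hsingle : ∀ j ∈ Finset.Icc 2 m, ∏ k ∈ Finset.Icc 1 (m + 1 + 1) \ {j}, P k =
      P (m + 1 + 1) * ∏ k ∈ Finset.Icc 1 (m + 1) \ {j}, P k := by
    intro j hj
    rw [Finset.mem_Icc] at hj
    rw [← Finset.prod_insert (by simp)]
    congr 1
    ext k
    simp only [Finset.mem_Icc, Finset.mem_insert, Finset.mem_sdiff, Finset.mem_singleton]
    omega
  have hlastpair : Finset.Icc 1 (m + 1 + 1) \ {m + 1, m + 1 + 1} = Finset.Icc 1 m := by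
    ext k
    simp only [Finset.mem_Icc, Finset.mem_insert, Finset.mem_sdiff, Finset.mem_singleton]
    omega
  have hlast : Finset.Icc 1 (m + 1 + 1) \ {m + 1} = insert (m + 1 + 1) (Finset.Icc 1 m) := by
    ext k
    simp only [Finset.mem_Icc, Finset.mem_insert, Finset.mem_sdiff, Finset.mem_singleton]
    omega
  rw [Finset.sum_Icc_succ_top (by omega), Finset.sum_Icc_succ_top (by omega),
    Finset.sum_congr rfl hpair, Finset.sum_congr rfl hsingle, hlastpair, hlast,
    Finset.prod_insert (by simp), ← Finset.mul_sum, ← Finset.mul_sum, hfirst, Nat.add_sub_cancel]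
  ring

/-- The quotient `N` also satisfies a congruence relating it to the two last exponents, which is
what allows the cancellation to be continued when one more exponent is adjoined. -/
theorem exists_numerator_eq {R : Type*} [CommRing R] (x : R) (ν : ℕ → ℕ) (n : ℕ) (hn : 2 ≤ n)
    (hgcd : ∀ j, 1 ≤ j → j ≤ n - 1 → Nat.gcd (ν j) (ν (j + 1)) = 1)
    (hdvd : ∀ j, 2 ≤ j → j ≤ n - 1 → ν j ∣ ν (j - 1) + ν (j + 1)) :
    ∃ N : R,
      ((∑ j ∈ Finset.Icc 1 (n - 1), ∏ k ∈ Finset.Icc 1 n \ {j, j + 1}, (x ^ ν k - 1))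
        + ∑ j ∈ Finset.Icc 2 (n - 1), ∏ k ∈ Finset.Icc 1 n \ {j}, (x ^ ν k - 1)) =
        (∏ j ∈ Finset.Icc 2 (n - 1), (x ^ ν j - 1)) * N ∧
      ∑ i ∈ Finset.range (ν n), x ^ i ∣
        N * ∑ i ∈ Finset.range (ν (n - 1)), x ^ i - ∑ i ∈ Finset.range (ν 1), x ^ i := by
  induction n, hn using Nat.le_induction with
  | base =>
    have h : Finset.Icc 1 2 \ {1, 1 + 1} = (∅ : Finset ℕ) := by decide
    exact ⟨1, by simp [h], by simp⟩
  | succ n hn ih =>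
    obtain ⟨N, hN, u, hu⟩ := ih (fun j h₁ h₂ => hgcd j h₁ (by omega))
      (fun j h₁ h₂ => hdvd j h₁ (by omega))
    have hcop : IsCoprime (∑ i ∈ Finset.range (ν n), x ^ i)
        (∑ i ∈ Finset.range (ν (n - 1)), x ^ i) := by
      have := hgcd (n - 1) (by omega) (by omega)
      rw [Nat.sub_add_cancel (by omega)] at this
      exact (isCoprime_geom_sum x this).symm
    obtain ⟨v, hv⟩ := geom_sum_dvd_geom_sum x (hdvd n hn (by omega))
    rw [add_comm (ν (n - 1)), geom_sum_add] at hv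
    obtain ⟨M, hM⟩ : ∑ i ∈ Finset.range (ν n), x ^ i ∣
        N * ∑ i ∈ Finset.range (ν (n + 1)), x ^ i
          + (∑ i ∈ Finset.range (ν 1), x ^ i) * x ^ ν (n + 1) := by
      refine hcop.dvd_of_dvd_mul_right
        ⟨u * ∑ i ∈ Finset.range (ν (n + 1)), x ^ i + (∑ i ∈ Finset.range (ν 1), x ^ i) * v, ?_⟩
      linear_combination (∑ i ∈ Finset.range (ν (n + 1)), x ^ i) * hu +
        (∑ i ∈ Finset.range (ν 1), x ^ i) * hv
    refine ⟨M, ?_, N + (∑ i ∈ Finset.range (ν 1), x ^ i) * (x - 1), ?_⟩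
    · have hD : ∏ j ∈ Finset.Icc 2 n, (x ^ ν j - 1) =
          (∏ j ∈ Finset.Icc 2 (n - 1), (x ^ ν j - 1)) * (x ^ ν n - 1) := by
        obtain ⟨m, rfl⟩ : ∃ m, n = m + 1 := ⟨n - 1, by omega⟩
        rw [Finset.prod_Icc_succ_top (by omega), Nat.add_sub_cancel]
      rw [Nat.add_sub_cancel, numerator_succ (fun k => x ^ ν k - 1) hn, hN, hD,
        ← geom_sum_mul x (ν 1), ← geom_sum_mul x (ν n)]
      linear_combination (∏ j ∈ Finset.Icc 2 (n - 1), (x ^ ν j - 1)) * ((x - 1) * hM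
        - N * geom_sum_mul x (ν (n + 1)))
    · rw [Nat.add_sub_cancel]
      linear_combination -hM -
        (∑ i ∈ Finset.range (ν 1), x ^ i) * geom_sum_mul x (ν (n + 1))

/-- Lemma 2.4 (denominator cancellation): if consecutive `ν_j` are coprime and each `ν_j`
divides `ν_{j-1} + ν_{j+1}`, then `∏_{j=2}^{n-1} (T^{ν_j} − 1)` divides
`Σ_{j=1}^{n-1} ∏_{k ≠ j, j+1} (T^{ν_k} − 1) + Σ_{j=2}^{n-1} ∏_{k ≠ j} (T^{ν_k} − 1)`
in `ℤ[T]`. -/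
theorem stmt_6 (n : ℕ) (hn : 2 ≤ n) (ν : ℕ → ℕ)
    (hpos : ∀ j, 1 ≤ j → j ≤ n → 0 < ν j)
    (hgcd : ∀ j, 1 ≤ j → j ≤ n - 1 → Nat.gcd (ν j) (ν (j + 1)) = 1)
    (hdvd : ∀ j, 2 ≤ j → j ≤ n - 1 → ν j ∣ ν (j - 1) + ν (j + 1)) :
    (∏ j ∈ Finset.Icc 2 (n - 1), ((X : ℤ[X]) ^ ν j - 1)) ∣
      ((∑ j ∈ Finset.Icc 1 (n - 1),
          ∏ k ∈ Finset.Icc 1 n \ {j, j + 1}, ((X : ℤ[X]) ^ ν k - 1))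
        + ∑ j ∈ Finset.Icc 2 (n - 1),
            ∏ k ∈ Finset.Icc 1 n \ {j}, ((X : ℤ[X]) ^ ν k - 1)) := by
  obtain ⟨N, hN, -⟩ := exists_numerator_eq (X : ℤ[X]) ν n hn hgcd hdvd
  exact ⟨N, hN⟩
end

section
/- Let n ≥ 2 be an integer, and let q > 1 and s > 0 be real numbers. Then Σ_{j=1}^{n−1} (q−1)/((q^{2js+j+1} − 1)(q^{(2j+2)s+j+2} − 1)) + q/(q^{2s+2} − 1) + Σ_{j=2}^{n−1} (q−1)/(q^{2js+j+1} − 1) = (1 + Σ_{j=1}^{n−1} q^{2js+j+1}) / (q^{2ns+n+1} − 1). -/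
/-- `1 + ∑_{0 < j < n} q t^j` in closed form, cleared of its denominator `t - 1`. -/
theorem one_add_sum_mul_pow_mul_sub_one (q t : ℝ) (n : ℕ) (hn : 1 ≤ n) :
    (1 + ∑ j ∈ Finset.Ico 1 n, q * t ^ j) * (t - 1) = t - 1 + q * (t ^ n - t) := by
  induction n, hn using Nat.le_induction with
  | base => simp
  | succ n hn ih =>
    rw [Finset.sum_Ico_succ_top hn]
    linear_combination ih

/-- The closed form in terms of `q` and `t = q^{2s+1}`, for which `q^{2js+j+1} = q t^j`. -/
theorem sum_geometric_fractions {q t : ℝ} (hq : 1 < q) (ht : 1 < t) (n : ℕ) (hn : 2 ≤ n) :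
    (∑ j ∈ Finset.Ico 1 n, (q - 1) / ((q * t ^ j - 1) * (q * t ^ (j + 1) - 1)))
      + q / (q * t - 1) + ∑ j ∈ Finset.Ico 2 n, (q - 1) / (q * t ^ j - 1)
    = (1 + ∑ j ∈ Finset.Ico 1 n, q * t ^ j) / (q * t ^ n - 1) := by
  have ne (j : ℕ) : q * t ^ j - 1 ≠ 0 :=
    (sub_pos.2 (one_lt_mul_of_lt_of_le hq (one_le_pow₀ ht.le))).ne'
  induction n, hn using Nat.le_induction with
  | base =>
    have h1 := ne 1
    have h2 := ne 2
    rw [pow_one] at h1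
    simp
    field_simp
    ring
  | succ n hn ih =>
    have hn1 : 1 ≤ n := by lia
    have hS := one_add_sum_mul_pow_mul_sub_one q t n hn1
    rw [Finset.sum_Ico_succ_top hn1, Finset.sum_Ico_succ_top hn,
      Finset.sum_Ico_succ_top hn1 (fun j => q * t ^ j)]
    have h1 := ne n
    have h2 := ne (n + 1)
    set S := ∑ j ∈ Finset.Ico 1 n, q * t ^ j
    have step : (q - 1) / ((q * t ^ n - 1) * (q * t ^ (n + 1) - 1)) + (q - 1) / (q * t ^ n - 1)
        = (1 + (S + q * t ^ n)) / (q * t ^ (n + 1) - 1) - (1 + S) / (q * t ^ n - 1) := by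
      rw [div_add_div _ _ (mul_ne_zero h1 h2) h1, div_sub_div _ _ h2 h1,
        div_eq_div_iff (mul_ne_zero (mul_ne_zero h1 h2) h1) (mul_ne_zero h2 h1)]
      linear_combination (q * t ^ n - 1) ^ 2 * (q * t ^ (n + 1) - 1) * (q * t ^ n) * hS
    linear_combination ih + step


/-- Closed-form evaluation of the partial sum `S̃₀` for the `A_{2n−1}`-singularity:
the contributions of the divisors with data `N_j = 2j`, `ν_j = j+1` sum to
`(1 + Σ_{j=1}^{n−1} q^{2js+j+1})/(q^{2ns+n+1} − 1)`. -/
theorem stmt_9 (n : ℕ) (hn : 2 ≤ n) (q s : ℝ) (hq : 1 < q) (hs : 0 < s) :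
    (∑ j ∈ Finset.Icc 1 (n - 1),
        (q - 1) / ((q ^ (2 * (j : ℝ) * s + (j : ℝ) + 1) - 1)
          * (q ^ ((2 * (j : ℝ) + 2) * s + (j : ℝ) + 2) - 1)))
      + q / (q ^ (2 * s + 2) - 1)
      + (∑ j ∈ Finset.Icc 2 (n - 1),
          (q - 1) / (q ^ (2 * (j : ℝ) * s + (j : ℝ) + 1) - 1))
    = (1 + ∑ j ∈ Finset.Icc 1 (n - 1), q ^ (2 * (j : ℝ) * s + (j : ℝ) + 1))
        / (q ^ (2 * (n : ℝ) * s + (n : ℝ) + 1) - 1) := by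
  have hq0 : 0 < q := one_pos.trans hq
  have ht : 1 < q ^ (2 * s + 1) := Real.one_lt_rpow hq (by positivity)
  have key (j : ℕ) : q ^ (2 * (j : ℝ) * s + (j : ℝ) + 1) = q * (q ^ (2 * s + 1)) ^ j := by
    rw [← Real.rpow_mul_natCast hq0.le, mul_comm q, ← Real.rpow_add_one hq0.ne']
    ring_nf
  have key_succ (j : ℕ) : q ^ ((2 * (j : ℝ) + 2) * s + (j : ℝ) + 2)
      = q * (q ^ (2 * s + 1)) ^ (j + 1) := by
    rw [← key]
    push_cast
    ring_nf
  have key_one : q ^ (2 * s + 2) = q * q ^ (2 * s + 1) := by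
    rw [mul_comm q, ← Real.rpow_add_one hq0.ne']
    ring_nf
  have hIcc (a : ℕ) : Finset.Icc a (n - 1) = Finset.Ico a n := by
    ext j
    simp only [Finset.mem_Icc, Finset.mem_Ico]
    lia
  simp only [key, key_succ, key_one, hIcc]
  exact sum_geometric_fractions hq ht n hn
end

section
/- Let p be an odd prime, let n ≥ 1 be an integer, and let s > 0 be real. Let μ be the Haar measure on ℚ_p² normalized so that μ(ℤ_p²) = 1. Then ∫_{ℤ_p²} |y² − x^{2n+1}|_p^s dμ(x,y) = (p−1) · [ (p^{s+1} − 1)(p^{2ns+n+1} + 1) · Σ_{j=1}^{n} p^{2js+j−1} + p^{(2n+1)s+n} · ( p^{(2n+1)s+n+1}(p^{s+2} − 1) + p^{s+1} − 1 ) ] / [ (p^{(4n+2)s+2n+3} − 1)(p^{s+1} − 1) ]. -/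
open MeasureTheory

open Metric

/-- Haar measures are determined by their value on a compact set with nonempty interior. -/
theorem eq_smul_of_apply_eq {G : Type*} [AddCommGroup G] [TopologicalSpace G]
    [IsTopologicalAddGroup G] [SecondCountableTopology G] [MeasurableSpace G] [BorelSpace G]
    (μ ν : Measure G) [SigmaFinite μ] [SigmaFinite ν] [μ.IsAddLeftInvariant]
    [ν.IsAddLeftInvariant] (K : TopologicalSpace.PositiveCompacts G) (c : ENNReal)
    (h : μ K = c * ν K) : μ = c • ν := by
  rw [Measure.addHaarMeasure_unique μ K, Measure.addHaarMeasure_unique ν K, h, smul_smul]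

section PadicHaar

variable {p : ℕ} [hp : Fact p.Prime]

/-- The closed unit ball of `ℚ_[p]`, as a compact set with nonempty interior. -/
noncomputable def padicUnitBall (p : ℕ) [Fact p.Prime] :
    TopologicalSpace.PositiveCompacts ℚ_[p] where
  carrier := closedBall 0 1
  isCompact' := isCompact_closedBall 0 1
  interior_nonempty' := ⟨0, ball_subset_interior_closedBall (mem_ball_self one_pos)⟩

theorem closedBall_zero_one_eq_iUnion :
    closedBall (0 : ℚ_[p]) 1 = ⋃ i : Fin p, closedBall ((i : ℕ) : ℚ_[p]) (p : ℝ)⁻¹ := by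
  ext x
  have key : ∀ z : ℚ_[p], ‖z‖ ≤ (p : ℝ)⁻¹ ↔ ‖z‖ < 1 := fun z ↦ by
    have := Padic.norm_le_pow_iff_norm_lt_pow_add_one z (-1)
    simpa using this
  simp only [mem_closedBall, Set.mem_iUnion, dist_eq_norm, sub_zero, key]
  constructor
  · intro hx
    obtain ⟨y, rfl⟩ : ∃ y : ℤ_[p], (y : ℚ_[p]) = x := ⟨⟨x, hx⟩, rfl⟩
    refine ⟨⟨_, PadicInt.zmodRepr_lt_p y⟩, ?_⟩
    have := PadicInt.norm_sub_zmodRepr_lt_one y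
    rwa [PadicInt.norm_def, PadicInt.coe_sub, PadicInt.coe_natCast] at this
  · rintro ⟨i, hi⟩
    have := Padic.nonarchimedean (x - ((i : ℕ) : ℚ_[p])) ((i : ℕ) : ℚ_[p])
    rw [sub_add_cancel] at this
    exact this.trans (max_le hi.le (by simpa using Padic.norm_int_le_one (p := p) (i : ℕ)))

theorem pairwise_disjoint_closedBall_natCast :
    Pairwise (Function.onFun Disjoint
      fun i : Fin p ↦ closedBall ((i : ℕ) : ℚ_[p]) (p : ℝ)⁻¹) := by
  intro i j hij
  rw [Function.onFun, Set.disjoint_left]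
  intro x hi hj
  apply hij
  rw [mem_closedBall, dist_eq_norm] at hi hj
  have h : ‖((i : ℕ) : ℚ_[p]) - (j : ℕ)‖ < 1 := by
    have := Padic.nonarchimedean (x - ((j : ℕ) : ℚ_[p])) (((i : ℕ) : ℚ_[p]) - x)
    rw [sub_add_sub_comm, add_comm x, add_sub_add_right_eq_sub, norm_sub_rev _ x] at this
    exact (this.trans (max_le hj hi)).trans_lt
      (inv_lt_one_of_one_lt₀ (by exact_mod_cast hp.out.one_lt))
  have h' : ‖(((i : ℕ) - (j : ℕ) : ℤ) : ℚ_[p])‖ < 1 := by push_cast; exact h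
  rw [Padic.norm_intCast_lt_one_iff] at h'
  have := (Int.modEq_iff_dvd.2 h')
  have := (Int.natCast_modEq_iff.1 this).symm
  exact Fin.ext (Nat.ModEq.eq_of_lt_of_lt this i.2 j.2)

theorem preimage_prime_pow_mul_closedBall (k : ℕ) :
    (fun x : ℚ_[p] ↦ (p : ℚ_[p]) ^ k * x) ⁻¹' closedBall 0 ((p : ℝ)⁻¹ ^ k) = closedBall 0 1 := by
  have hP : (0 : ℝ) < p := by exact_mod_cast hp.out.pos
  ext x
  simp [hP]

theorem closedBall_prime_pow_eq_union (k : ℕ) :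
    closedBall (0 : ℚ_[p]) ((p : ℝ)⁻¹ ^ k)
      = sphere 0 ((p : ℝ)⁻¹ ^ k) ∪ closedBall 0 ((p : ℝ)⁻¹ ^ (k + 1)) := by
  ext x
  have := Padic.norm_le_pow_iff_norm_lt_pow_add_one x (-(k + 1 : ℕ))
  rw [show (-(k + 1 : ℕ) + 1 : ℤ) = -(k : ℕ) by push_cast; ring] at this
  simp only [zpow_neg, zpow_natCast] at this
  simp only [Set.mem_union, mem_closedBall, mem_sphere, dist_zero_right, inv_pow, this,
    le_iff_eq_or_lt]

theorem disjoint_sphere_closedBall_prime_pow (k : ℕ) :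
    Disjoint (sphere (0 : ℚ_[p]) ((p : ℝ)⁻¹ ^ k)) (closedBall 0 ((p : ℝ)⁻¹ ^ (k + 1))) := by
  refine (sphere_disjoint_ball (x := (0 : ℚ_[p]))).mono_right (closedBall_subset_ball ?_)
  have h : (1 : ℝ) < p := by exact_mod_cast hp.out.one_lt
  exact pow_lt_pow_right_of_lt_one₀ (by positivity) (inv_lt_one_of_one_lt₀ h) k.lt_succ_self

theorem closedBall_prime_pow_subset (k : ℕ) :
    closedBall (0 : ℚ_[p]) ((p : ℝ)⁻¹ ^ k) ⊆ closedBall 0 1 :=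
  closedBall_subset_closedBall <| pow_le_one₀ (by positivity)
    (inv_le_one_of_one_le₀ (by exact_mod_cast hp.out.one_le))

theorem continuous_cusp {m : ℕ} {s : ℝ} (hs : 0 < s) :
    Continuous fun z : ℚ_[p] × ℚ_[p] ↦ ‖z.2 ^ 2 - z.1 ^ m‖ ^ s :=
  Continuous.rpow_const (by fun_prop) fun _ ↦ Or.inr hs.le

theorem norm_cusp_rpow_of_lt {m : ℕ} {s : ℝ} {x y : ℚ_[p]} (h : ‖x‖ ^ m < ‖y‖ ^ 2) :
    ‖y ^ 2 - x ^ m‖ ^ s = (‖y‖ ^ s) ^ 2 := by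
  rw [sub_eq_add_neg, IsUltrametricDist.norm_add_eq_max_of_norm_ne_norm (by
    rw [norm_neg, norm_pow, norm_pow]; exact h.ne'), norm_neg, norm_pow, norm_pow,
    max_eq_left h.le, Real.rpow_pow_comm (norm_nonneg y)]

theorem norm_cusp_rpow_of_gt {m : ℕ} {s : ℝ} {x y : ℚ_[p]} (h : ‖y‖ ^ 2 < ‖x‖ ^ m) :
    ‖y ^ 2 - x ^ m‖ ^ s = (‖x‖ ^ s) ^ m := by
  rw [sub_eq_add_neg, IsUltrametricDist.norm_add_eq_max_of_norm_ne_norm (by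
    rw [norm_neg, norm_pow, norm_pow]; exact h.ne), norm_neg, norm_pow, norm_pow,
    max_eq_right h.le, Real.rpow_pow_comm (norm_nonneg x)]

variable [MeasurableSpace ℚ_[p]] [BorelSpace ℚ_[p]] (ν : Measure ℚ_[p]) [ν.IsAddHaarMeasure]

theorem measure_closedBall_inv :
    ν (closedBall 0 1) = p * ν (closedBall 0 (p : ℝ)⁻¹) := by
  rw [closedBall_zero_one_eq_iUnion, measure_iUnion pairwise_disjoint_closedBall_natCast
    (fun _ ↦ measurableSet_closedBall)]
  simp [Measure.addHaar_closedBall_center, tsum_fintype]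

theorem map_mul_left_eq_smul (hν : ν (closedBall 0 1) = 1) {c : ℚ_[p]} (hc : c ≠ 0) :
    ν.map (c * ·) = ν (closedBall 0 ‖c‖⁻¹) • ν := by
  have : (ν.map (c * ·)).IsAddHaarMeasure :=
    (DistribMulAction.toAddEquiv ℚ_[p] (Units.mk0 c hc)).isAddHaarMeasure_map ν
      (continuous_const_mul c) (continuous_const_mul c⁻¹)
  refine eq_smul_of_apply_eq _ _ (padicUnitBall p) _ ?_
  change ν.map (c * ·) (closedBall 0 1) = _ * ν (closedBall 0 1)
  rw [hν, mul_one, Measure.map_apply (measurable_const_mul c) measurableSet_closedBall]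
  congr 1
  ext x
  have := norm_pos_iff.2 hc
  simp [← one_div, le_div_iff₀', this]

theorem map_mul_left_of_norm_eq_one (hν : ν (closedBall 0 1) = 1) {c : ℚ_[p]} (hc : ‖c‖ = 1) :
    ν.map (c * ·) = ν := by
  rw [map_mul_left_eq_smul ν hν (by rintro rfl; simp at hc), hc, inv_one, hν, one_smul]

theorem map_prime_mul_left (hν : ν (closedBall 0 1) = 1) :
    ν.map ((p : ℚ_[p]) * ·) = (p : ENNReal) • ν := by
  have hp0 : (p : ℚ_[p]) ≠ 0 := by exact_mod_cast hp.out.ne_zero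
  have h := map_mul_left_eq_smul ν hν hp0
  have h1 := congrArg (· (closedBall 0 (p : ℝ)⁻¹)) h
  have hP : (0 : ℝ) < p := by exact_mod_cast hp.out.pos
  have h2 : (fun x : ℚ_[p] ↦ (p : ℚ_[p]) * x) ⁻¹' closedBall 0 (p : ℝ)⁻¹ = closedBall 0 1 := by
    ext x
    simp [hP]
  simp only [Measure.map_apply (measurable_const_mul (p : ℚ_[p])) measurableSet_closedBall, h2,
    Measure.smul_apply, smul_eq_mul, hν] at h1
  have h3 := measure_closedBall_inv ν
  rw [hν] at h3
  rw [h]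
  congr 1
  have h4 : ν (closedBall 0 (p : ℝ)⁻¹) ≠ 0 := fun h0 ↦ by simp [h0] at h3
  have h5 : ν (closedBall 0 (p : ℝ)⁻¹) ≠ ⊤ := measure_closedBall_lt_top.ne
  exact (ENNReal.mul_left_inj h4 h5).1 (h1.symm.trans h3)

theorem map_prime_pow_mul_left (hν : ν (closedBall 0 1) = 1) (k : ℕ) :
    ν.map ((p : ℚ_[p]) ^ k * ·) = (p : ENNReal) ^ k • ν := by
  induction k with
  | zero => simp
  | succ k ih =>
    have : (fun x : ℚ_[p] ↦ (p : ℚ_[p]) ^ (k + 1) * x) =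
        (fun x ↦ (p : ℚ_[p]) * x) ∘ (fun x ↦ (p : ℚ_[p]) ^ k * x) := by
      ext x; simp [pow_succ']; ring
    rw [this, ← Measure.map_map (measurable_const_mul _) (measurable_const_mul _), ih,
      Measure.map_smul, map_prime_mul_left ν hν, smul_smul, pow_succ]

theorem measurableEmbedding_mul_left {c : ℚ_[p]} (hc : c ≠ 0) :
    MeasurableEmbedding (fun x : ℚ_[p] ↦ c * x) :=
  (Homeomorph.mulLeft₀ c hc).measurableEmbedding

theorem setIntegral_closedBall_prime_pow (hν : ν (closedBall 0 1) = 1) (k : ℕ) (g : ℚ_[p] → ℝ) :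
    ∫ x in closedBall 0 ((p : ℝ)⁻¹ ^ k), g x ∂ν
      = (p : ℝ)⁻¹ ^ k * ∫ x in closedBall 0 1, g ((p : ℚ_[p]) ^ k * x) ∂ν := by
  have hp0 : (p : ℚ_[p]) ^ k ≠ 0 := pow_ne_zero _ (by exact_mod_cast hp.out.ne_zero)
  have hP : (p : ℝ) ≠ 0 := by exact_mod_cast hp.out.ne_zero
  have h := (measurableEmbedding_mul_left hp0).setIntegral_map (μ := ν) g
    (closedBall 0 ((p : ℝ)⁻¹ ^ k))
  rw [preimage_prime_pow_mul_closedBall, map_prime_pow_mul_left ν hν, Measure.restrict_smul,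
    integral_smul_measure] at h
  rw [← h]
  simp [hP]

theorem setIntegral_sphere_mul_left (hν : ν (closedBall 0 1) = 1) {c : ℚ_[p]} (hc : ‖c‖ = 1)
    (g : ℚ_[p] → ℝ) :
    ∫ x in sphere 0 1, g (c * x) ∂ν = ∫ x in sphere 0 1, g x ∂ν := by
  have hc0 : c ≠ 0 := by rintro rfl; simp at hc
  have h := (measurableEmbedding_mul_left hc0).setIntegral_map (μ := ν) g (sphere 0 1)
  rw [map_mul_left_of_norm_eq_one ν hν hc] at h
  rw [h]
  congr 3
  ext x
  simp [hc]

theorem measureReal_closedBall_prime_pow (hν : ν (closedBall 0 1) = 1) (k : ℕ) :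
    ν.real (closedBall 0 ((p : ℝ)⁻¹ ^ k)) = (p : ℝ)⁻¹ ^ k := by
  have := setIntegral_closedBall_prime_pow ν hν k fun _ ↦ 1
  simpa [measureReal_def, hν] using this

theorem measureReal_sphere_prime_pow (hν : ν (closedBall 0 1) = 1) (k : ℕ) :
    ν.real (sphere 0 ((p : ℝ)⁻¹ ^ k)) = (p : ℝ)⁻¹ ^ k * (1 - (p : ℝ)⁻¹) := by
  have h := measureReal_union (μ := ν) (disjoint_sphere_closedBall_prime_pow (p := p) k)
    measurableSet_closedBall
    (measure_ne_top_of_subset sphere_subset_closedBall measure_closedBall_lt_top.ne)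
    measure_closedBall_lt_top.ne
  rw [← closedBall_prime_pow_eq_union, measureReal_closedBall_prime_pow ν hν,
    measureReal_closedBall_prime_pow ν hν] at h
  linear_combination -h

theorem measureReal_sphere_zero_one (hν : ν (closedBall 0 1) = 1) :
    ν.real (sphere 0 1) = 1 - (p : ℝ)⁻¹ := by
  simpa using measureReal_sphere_prime_pow ν hν 0

theorem setIntegral_closedBall_eq_add {f : ℚ_[p] → ℝ} (hf : Continuous f) :
    ∫ x in closedBall 0 1, f x ∂ν
      = ∫ x in sphere 0 1, f x ∂ν + ∫ x in closedBall 0 (p : ℝ)⁻¹, f x ∂ν := by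
  have hU := closedBall_prime_pow_eq_union (p := p) 0
  have hd := disjoint_sphere_closedBall_prime_pow (p := p) 0
  simp only [pow_zero, zero_add, pow_one] at hU hd
  have hi : IntegrableOn f (closedBall 0 1) ν :=
    hf.continuousOn.integrableOn_compact (isCompact_closedBall 0 1)
  rw [hU] at hi ⊢
  exact setIntegral_union hd measurableSet_closedBall hi.left_of_union hi.right_of_union

theorem setIntegral_eq_const_mul_measureReal {α : Type*} [MeasurableSpace α] {μ : Measure α}
    {S : Set α} (hS : MeasurableSet S) {f : α → ℝ} {c : ℝ} (h : ∀ x ∈ S, f x = c) :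
    ∫ x in S, f x ∂μ = μ.real S * c := by
  rw [setIntegral_congr_fun hS h, setIntegral_const, smul_eq_mul]

theorem setIntegral_norm_rpow (hν : ν (closedBall 0 1) = 1) {s : ℝ} (hs : 0 < s) :
    (∫ x in closedBall (0 : ℚ_[p]) 1, ‖x‖ ^ s ∂ν) * (1 - (p : ℝ)⁻¹ * (p : ℝ)⁻¹ ^ s)
      = 1 - (p : ℝ)⁻¹ := by
  have h1 := setIntegral_closedBall_eq_add ν (f := fun x : ℚ_[p] ↦ ‖x‖ ^ s)
    (continuous_norm.rpow_const fun _ ↦ Or.inr hs.le)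
  have h2 := setIntegral_closedBall_prime_pow ν hν 1 fun x ↦ ‖x‖ ^ s
  simp only [pow_one, norm_mul, Padic.norm_p] at h2
  simp_rw [Real.mul_rpow (inv_nonneg.2 (Nat.cast_nonneg p)) (norm_nonneg _)] at h2
  rw [integral_const_mul] at h2
  rw [setIntegral_eq_const_mul_measureReal (c := 1) isClosed_sphere.measurableSet
    (fun x hx ↦ by simp [mem_sphere_zero_iff_norm.1 hx]), h2,
    measureReal_sphere_zero_one ν hν] at h1
  linear_combination h1

theorem setIntegral_sphere_norm_sub_rpow (hν : ν (closedBall 0 1) = 1) {s : ℝ} (hs : 0 < s)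
    {a : ℚ_[p]} (ha : ‖a‖ = 1) :
    ∫ x in sphere 0 1, ‖a - x‖ ^ s ∂ν
      = ∫ x in closedBall (0 : ℚ_[p]) 1, ‖x‖ ^ s ∂ν - (p : ℝ)⁻¹ := by
  have h1 := setIntegral_closedBall_eq_add ν (f := fun x : ℚ_[p] ↦ ‖a - x‖ ^ s)
    ((continuous_const.sub continuous_id).norm.rpow_const fun _ ↦ Or.inr hs.le)
  have h2 := (Measure.measurePreserving_sub_left ν a).setIntegral_preimage_emb
    (Homeomorph.subLeft a).measurableEmbedding (fun x ↦ ‖x‖ ^ s) (closedBall 0 1)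
  have h3 : (fun x ↦ a - x) ⁻¹' closedBall 0 1 = closedBall 0 1 := by
    ext x
    simp only [Set.mem_preimage, mem_closedBall_zero_iff]
    constructor
    · intro h
      simpa using
        (Padic.nonarchimedean a (-(a - x))).trans (max_le ha.le (by rwa [norm_neg]))
    · intro h
      rw [sub_eq_add_neg]
      exact (Padic.nonarchimedean a (-x)).trans (max_le ha.le (by simpa using h))
  have h4 : ∀ x ∈ closedBall (0 : ℚ_[p]) (p : ℝ)⁻¹, ‖a - x‖ ^ s = 1 := fun x hx ↦ by
    have hx' : ‖x‖ < 1 := (mem_closedBall_zero_iff.1 hx).trans_lt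
      (inv_lt_one_of_one_lt₀ (by exact_mod_cast hp.out.one_lt))
    rw [sub_eq_add_neg, IsUltrametricDist.norm_add_eq_max_of_norm_ne_norm (by
      rw [norm_neg, ha]; exact hx'.ne'), norm_neg, ha, max_eq_left hx'.le, Real.one_rpow]
  have h5 := measureReal_closedBall_prime_pow ν hν 1
  rw [pow_one] at h5
  rw [h3] at h2
  rw [setIntegral_eq_const_mul_measureReal measurableSet_closedBall h4, h5, h2] at h1
  linear_combination -h1

section Product

variable {F : ℚ_[p] × ℚ_[p] → ℝ}

theorem integrableOn_unit_square (hF : Continuous F) :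
    IntegrableOn F (closedBall 0 1 ×ˢ closedBall 0 1) (ν.prod ν) :=
  hF.continuousOn.integrableOn_compact ((isCompact_closedBall 0 1).prod (isCompact_closedBall 0 1))

theorem setIntegral_prod_closedBall_left (hF : Continuous F) (k : ℕ) :
    ∫ z in closedBall 0 ((p : ℝ)⁻¹ ^ k) ×ˢ closedBall 0 1, F z ∂ν.prod ν
      = ∫ z in sphere 0 ((p : ℝ)⁻¹ ^ k) ×ˢ closedBall 0 1, F z ∂ν.prod ν
        + ∫ z in closedBall 0 ((p : ℝ)⁻¹ ^ (k + 1)) ×ˢ closedBall 0 1, F z ∂ν.prod ν := by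
  have hi := (integrableOn_unit_square ν hF).mono_set
    (Set.prod_mono_left (closedBall_prime_pow_subset k))
  rw [closedBall_prime_pow_eq_union, Set.union_prod] at hi ⊢
  exact setIntegral_union (Set.disjoint_prod.2 (.inl (disjoint_sphere_closedBall_prime_pow k)))
    (measurableSet_closedBall.prod measurableSet_closedBall) hi.left_of_union hi.right_of_union

theorem setIntegral_prod_closedBall_right (hF : Continuous F) {S : Set ℚ_[p]}
    (hS : MeasurableSet S) (hS' : S ⊆ closedBall 0 1) (k : ℕ) :
    ∫ z in S ×ˢ closedBall 0 ((p : ℝ)⁻¹ ^ k), F z ∂ν.prod ν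
      = ∫ z in S ×ˢ sphere 0 ((p : ℝ)⁻¹ ^ k), F z ∂ν.prod ν
        + ∫ z in S ×ˢ closedBall 0 ((p : ℝ)⁻¹ ^ (k + 1)), F z ∂ν.prod ν := by
  have hi := (integrableOn_unit_square ν hF).mono_set
    (Set.prod_mono hS' (closedBall_prime_pow_subset k))
  rw [closedBall_prime_pow_eq_union, Set.prod_union] at hi ⊢
  exact setIntegral_union (Set.disjoint_prod.2 (.inr (disjoint_sphere_closedBall_prime_pow k)))
    (hS.prod measurableSet_closedBall) hi.left_of_union hi.right_of_union

theorem setIntegral_prod_eq_sum_add (hF : Continuous F) {S : Set ℚ_[p]}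
    (hS : MeasurableSet S) (hS' : S ⊆ closedBall 0 1) (N : ℕ) :
    ∫ z in S ×ˢ closedBall 0 1, F z ∂ν.prod ν
      = ∑ b ∈ Finset.range N, ∫ z in S ×ˢ sphere 0 ((p : ℝ)⁻¹ ^ b), F z ∂ν.prod ν
        + ∫ z in S ×ˢ closedBall 0 ((p : ℝ)⁻¹ ^ N), F z ∂ν.prod ν := by
  induction N with
  | zero => simp
  | succ N ih =>
    rw [ih, setIntegral_prod_closedBall_right ν hF hS hS', Finset.sum_range_succ, add_assoc]

theorem setIntegral_prod_closedBall_prime_pow (hν : ν (closedBall 0 1) = 1) (hF : Continuous F)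
    (j k : ℕ) :
    ∫ z in closedBall 0 ((p : ℝ)⁻¹ ^ j) ×ˢ closedBall 0 ((p : ℝ)⁻¹ ^ k), F z ∂ν.prod ν
      = (p : ℝ)⁻¹ ^ j * (p : ℝ)⁻¹ ^ k * ∫ z in closedBall 0 1 ×ˢ closedBall 0 1,
          F ((p : ℚ_[p]) ^ j * z.1, (p : ℚ_[p]) ^ k * z.2) ∂ν.prod ν := by
  rw [setIntegral_prod _ ((integrableOn_unit_square ν hF).mono_set
    (Set.prod_mono (closedBall_prime_pow_subset j) (closedBall_prime_pow_subset k))),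
    setIntegral_prod _ (integrableOn_unit_square ν (by fun_prop)),
    setIntegral_closedBall_prime_pow ν hν]
  simp_rw [setIntegral_closedBall_prime_pow ν hν k]
  rw [integral_const_mul, mul_assoc]

end Product

theorem setIntegral_cusp_units (hν : ν (closedBall 0 1) = 1) (n : ℕ) {s : ℝ} (hs : 0 < s) :
    ∫ z in sphere 0 1 ×ˢ sphere 0 1, ‖z.2 ^ 2 - z.1 ^ (2 * n + 1)‖ ^ s ∂ν.prod ν
      = (1 - (p : ℝ)⁻¹) * (∫ x in closedBall (0 : ℚ_[p]) 1, ‖x‖ ^ s ∂ν - (p : ℝ)⁻¹) := by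
  have hsub : sphere (0 : ℚ_[p]) 1 ×ˢ sphere (0 : ℚ_[p]) 1 ⊆ closedBall 0 1 ×ˢ closedBall 0 1 :=
    Set.prod_mono sphere_subset_closedBall sphere_subset_closedBall
  have hm : MeasurableSet (sphere (0 : ℚ_[p]) 1) := isClosed_sphere.measurableSet
  have hu : ∀ x ∈ sphere (0 : ℚ_[p]) 1,
      ∫ y in sphere 0 1, ‖y ^ 2 - x ^ (2 * n + 1)‖ ^ s ∂ν
        = ∫ y in sphere 0 1, ‖y ^ 2 - x‖ ^ s ∂ν := fun x hx ↦ by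
    have hx : ‖x‖ = 1 := mem_sphere_zero_iff_norm.1 hx
    rw [← setIntegral_sphere_mul_left ν hν (c := x ^ n) (by simp [hx])]
    congr 1 with y
    rw [show (x ^ n * y) ^ 2 - x ^ (2 * n + 1) = x ^ (2 * n) * (y ^ 2 - x) by ring, norm_mul,
      norm_pow, hx, one_pow, one_mul]
  have hc : Continuous fun z : ℚ_[p] × ℚ_[p] ↦ ‖z.2 ^ 2 - z.1‖ ^ s := by
    simpa using continuous_cusp (p := p) (m := 1) hs
  have hc' : Continuous fun z : ℚ_[p] × ℚ_[p] ↦ ‖z.1 ^ 2 - z.2‖ ^ s :=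
    hc.comp continuous_swap
  rw [setIntegral_prod _ ((integrableOn_unit_square ν (continuous_cusp hs)).mono_set hsub),
    setIntegral_congr_fun hm hu,
    ← setIntegral_prod (fun z : ℚ_[p] × ℚ_[p] ↦ ‖z.2 ^ 2 - z.1‖ ^ s)
      ((integrableOn_unit_square ν hc).mono_set hsub), ← setIntegral_prod_swap]
  simp only [Prod.snd_swap, Prod.fst_swap]
  rw [setIntegral_prod _ ((integrableOn_unit_square ν hc').mono_set hsub),
    setIntegral_eq_const_mul_measureReal hm fun x hx ↦
      setIntegral_sphere_norm_sub_rpow ν hν hs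
      (a := x ^ 2) (by rw [norm_pow, mem_sphere_zero_iff_norm.1 hx, one_pow]),
    measureReal_sphere_zero_one ν hν]

theorem setIntegral_cusp_of_lt {m : ℕ} {s : ℝ} {S : Set ℚ_[p]} {r : ℝ}
    (hS : MeasurableSet S) (h : ∀ x ∈ S, ‖x‖ ^ m < r ^ 2) :
    ∫ z in S ×ˢ sphere 0 r, ‖z.2 ^ 2 - z.1 ^ m‖ ^ s ∂ν.prod ν
      = ν.real S * ν.real (sphere 0 r) * (r ^ s) ^ 2 := by
  rw [setIntegral_eq_const_mul_measureReal (hS.prod isClosed_sphere.measurableSet)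
    (c := (r ^ s) ^ 2), measureReal_prod_prod]
  rintro ⟨x, y⟩ ⟨hx, hy⟩
  rw [← mem_sphere_zero_iff_norm.1 hy]
  exact norm_cusp_rpow_of_lt (by rw [mem_sphere_zero_iff_norm.1 hy]; exact h x hx)

theorem setIntegral_cusp_of_gt {m : ℕ} {s : ℝ} {T : Set ℚ_[p]} {r : ℝ}
    (hT : MeasurableSet T) (h : ∀ y ∈ T, ‖y‖ ^ 2 < r ^ m) :
    ∫ z in sphere 0 r ×ˢ T, ‖z.2 ^ 2 - z.1 ^ m‖ ^ s ∂ν.prod ν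
      = ν.real (sphere 0 r) * ν.real T * (r ^ s) ^ m := by
  rw [setIntegral_eq_const_mul_measureReal (isClosed_sphere.measurableSet.prod hT)
    (c := (r ^ s) ^ m), measureReal_prod_prod]
  rintro ⟨x, y⟩ ⟨hx, hy⟩
  rw [← mem_sphere_zero_iff_norm.1 hx]
  exact norm_cusp_rpow_of_gt (by rw [mem_sphere_zero_iff_norm.1 hx]; exact h y hy)

theorem setIntegral_cusp_scaling (hν : ν (closedBall 0 1) = 1) (m : ℕ) {s : ℝ} (hs : 0 < s) :
    ∫ z in closedBall 0 ((p : ℝ)⁻¹ ^ 2) ×ˢ closedBall 0 ((p : ℝ)⁻¹ ^ m),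
        ‖z.2 ^ 2 - z.1 ^ m‖ ^ s ∂ν.prod ν
      = (p : ℝ)⁻¹ ^ (m + 2) * ((p : ℝ)⁻¹ ^ s) ^ (2 * m) *
        ∫ z in closedBall 0 1 ×ˢ closedBall 0 1, ‖z.2 ^ 2 - z.1 ^ m‖ ^ s ∂ν.prod ν := by
  have hp0 : (0 : ℝ) ≤ (p : ℝ)⁻¹ := by positivity
  have h (z : ℚ_[p] × ℚ_[p]) : ‖((p : ℚ_[p]) ^ m * z.2) ^ 2 - ((p : ℚ_[p]) ^ 2 * z.1) ^ m‖ ^ s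
      = ((p : ℝ)⁻¹ ^ s) ^ (2 * m) * ‖z.2 ^ 2 - z.1 ^ m‖ ^ s := by
    rw [show ((p : ℚ_[p]) ^ m * z.2) ^ 2 - ((p : ℚ_[p]) ^ 2 * z.1) ^ m
      = (p : ℚ_[p]) ^ (2 * m) * (z.2 ^ 2 - z.1 ^ m) by ring, norm_mul, norm_pow, Padic.norm_p,
      Real.mul_rpow (by positivity) (norm_nonneg _), Real.rpow_pow_comm hp0]
  rw [setIntegral_prod_closedBall_prime_pow ν hν (continuous_cusp hs)]
  simp_rw [h]
  rw [integral_const_mul]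
  ring

theorem setIntegral_cusp_recurrence (hν : ν (closedBall 0 1) = 1) (n : ℕ) {s q t Z J : ℝ}
    (hs : 0 < s) (hq : q = (p : ℝ)⁻¹) (ht : t = q ^ s)
    (hZ : Z = ∫ z in closedBall 0 1 ×ˢ closedBall 0 1,
      ‖z.2 ^ 2 - z.1 ^ (2 * n + 1)‖ ^ s ∂ν.prod ν)
    (hJ : J = ∫ x in closedBall (0 : ℚ_[p]) 1, ‖x‖ ^ s ∂ν) :
    Z = (1 - q) * (J - q) + (1 - q) * q
      + (q * (1 - q) ^ 2 * (∑ b ∈ Finset.range (n + 1), (q * t ^ 2) ^ b)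
        + (1 - q) * q ^ (n + 2) * t ^ (2 * n + 1))
      + (q ^ 2 * (1 - q) * (∑ b ∈ Finset.range (2 * n + 1), (q * t ^ 2) ^ b)
        + q ^ (2 * n + 3) * t ^ (2 * (2 * n + 1)) * Z) := by
  have hp1 : (1 : ℝ) < p := by exact_mod_cast hp.out.one_lt
  have hq0 : 0 < q := by rw [hq]; positivity
  have hq1 : q < 1 := by rw [hq]; exact inv_lt_one_of_one_lt₀ hp1
  have hF : Continuous fun z : ℚ_[p] × ℚ_[p] ↦ ‖z.2 ^ 2 - z.1 ^ (2 * n + 1)‖ ^ s :=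
    continuous_cusp hs
  have hB (k : ℕ) : ν.real (closedBall 0 (q ^ k)) = q ^ k := by
    rw [hq]; exact measureReal_closedBall_prime_pow ν hν k
  have hS (k : ℕ) : ν.real (sphere 0 (q ^ k)) = q ^ k * (1 - q) := by
    rw [hq]; exact measureReal_sphere_prime_pow ν hν k
  have hsm (r : ℝ) : MeasurableSet (sphere (0 : ℚ_[p]) r) := isClosed_sphere.measurableSet
  have hSB (k : ℕ) : sphere (0 : ℚ_[p]) (q ^ k) ⊆ closedBall 0 1 := by
    rw [hq]; exact sphere_subset_closedBall.trans (closedBall_prime_pow_subset k)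
  have hBB : closedBall (0 : ℚ_[p]) (q ^ 2) ⊆ closedBall 0 1 := by
    rw [hq]; exact closedBall_prime_pow_subset 2
  have hpow (k : ℕ) : (q ^ k) ^ s = t ^ k := by rw [ht, Real.rpow_pow_comm hq0.le]
  have hlt {a b : ℕ} (h : a < b) : q ^ b < q ^ a := pow_lt_pow_right_of_lt_one₀ hq0 hq1 h
  have e0 := setIntegral_prod_closedBall_left ν hF 0
  have e1 := setIntegral_prod_closedBall_left ν hF 1
  have e2 := setIntegral_prod_eq_sum_add ν hF (hsm _) (hSB 0) 1
  have e3 := setIntegral_prod_eq_sum_add ν hF (hsm _) (hSB 1) (n + 1)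
  have e4 := setIntegral_prod_eq_sum_add ν hF measurableSet_closedBall hBB (2 * n + 1)
  have eU := setIntegral_cusp_units ν hν n hs
  have eZ := setIntegral_cusp_scaling ν hν (2 * n + 1) hs
  rw [← hZ, ← hq, ← ht] at eZ
  rw [← hJ, ← hq] at eU
  have v2 : ∫ z in sphere 0 1 ×ˢ closedBall 0 (q ^ 1), ‖z.2 ^ 2 - z.1 ^ (2 * n + 1)‖ ^ s ∂ν.prod ν
      = (1 - q) * q := by
    rw [setIntegral_cusp_of_gt ν measurableSet_closedBall fun y hy ↦ ?_, hB, ← pow_zero q, hS, hpow]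
    · simp
    · rw [mem_closedBall_zero_iff, pow_one] at hy
      rw [one_pow]
      exact pow_lt_one₀ (norm_nonneg y) (hy.trans_lt hq1) two_ne_zero
  have v3 : ∫ z in sphere 0 (q ^ 1) ×ˢ closedBall 0 (q ^ (n + 1)),
      ‖z.2 ^ 2 - z.1 ^ (2 * n + 1)‖ ^ s ∂ν.prod ν = (1 - q) * q ^ (n + 2) * t ^ (2 * n + 1) := by
    rw [setIntegral_cusp_of_gt ν measurableSet_closedBall fun y hy ↦ ?_, hB, hS, hpow]
    · ring
    · rw [mem_closedBall_zero_iff] at hy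
      calc ‖y‖ ^ 2 ≤ (q ^ (n + 1)) ^ 2 := by gcongr
        _ < (q ^ 1) ^ (2 * n + 1) := by rw [← pow_mul, ← pow_mul]; exact hlt (by omega)
  have v3' : ∀ b ∈ Finset.range (n + 1), ∫ z in sphere 0 (q ^ 1) ×ˢ sphere 0 (q ^ b),
      ‖z.2 ^ 2 - z.1 ^ (2 * n + 1)‖ ^ s ∂ν.prod ν = q * (1 - q) ^ 2 * (q * t ^ 2) ^ b := by
    intro b hb
    rw [setIntegral_cusp_of_lt ν (hsm _) fun x hx ↦ ?_, hS, hS, hpow]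
    · ring
    · rw [Finset.mem_range] at hb
      rw [mem_sphere_zero_iff_norm.1 hx, ← pow_mul, ← pow_mul]
      exact hlt (by omega)
  have v4 : ∀ b ∈ Finset.range (2 * n + 1), ∫ z in closedBall 0 (q ^ 2) ×ˢ sphere 0 (q ^ b),
      ‖z.2 ^ 2 - z.1 ^ (2 * n + 1)‖ ^ s ∂ν.prod ν = q ^ 2 * (1 - q) * (q * t ^ 2) ^ b := by
    intro b hb
    rw [setIntegral_cusp_of_lt ν measurableSet_closedBall fun x hx ↦ ?_, hB, hS, hpow]
    · ring
    · rw [Finset.mem_range] at hb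
      rw [mem_closedBall_zero_iff] at hx
      calc ‖x‖ ^ (2 * n + 1) ≤ (q ^ 2) ^ (2 * n + 1) := by gcongr
        _ < (q ^ b) ^ 2 := by rw [← pow_mul, ← pow_mul]; exact hlt (by omega)
  rw [← hq, pow_zero, zero_add, ← hZ] at e0
  rw [← hq] at e1
  rw [← hq, Finset.sum_range_one, pow_zero, eU, v2] at e2
  rw [← hq, Finset.sum_congr rfl v3', v3, ← Finset.mul_sum] at e3
  rw [← hq, Finset.sum_congr rfl v4, eZ, ← Finset.mul_sum] at e4
  linear_combination e0 + e1 + e2 + e3 + e4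

end PadicHaar

/-- The value of the zeta function, solved from its recurrence, in terms of `P = p`, `T = p ^ s`. -/
theorem cusp_recurrence_solution {n : ℕ} {P T Z J : ℝ} (hP : 1 < P) (hT : 1 < T)
    (hJ : J * (1 - P⁻¹ * T⁻¹) = 1 - P⁻¹)
    (hZ : Z = (1 - P⁻¹) * (J - P⁻¹) + (1 - P⁻¹) * P⁻¹
      + (P⁻¹ * (1 - P⁻¹) ^ 2 * (∑ b ∈ Finset.range (n + 1), (P⁻¹ * T⁻¹ ^ 2) ^ b)
        + (1 - P⁻¹) * P⁻¹ ^ (n + 2) * T⁻¹ ^ (2 * n + 1))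
      + (P⁻¹ ^ 2 * (1 - P⁻¹) * (∑ b ∈ Finset.range (2 * n + 1), (P⁻¹ * T⁻¹ ^ 2) ^ b)
        + P⁻¹ ^ (2 * n + 3) * T⁻¹ ^ (2 * (2 * n + 1)) * Z)) :
    Z = (P - 1) * ((T * P - 1) * (T ^ (2 * n) * P ^ (n + 1) + 1) *
          (∑ j ∈ Finset.range n, T ^ (2 * (j + 1)) * P ^ j)
        + T ^ (2 * n + 1) * P ^ n *
          (T ^ (2 * n + 1) * P ^ (n + 1) * (T * P ^ 2 - 1) + T * P - 1)) /
      ((T ^ (4 * n + 2) * P ^ (2 * n + 3) - 1) * (T * P - 1)) := by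
  have hTP : 1 < T * P := one_lt_mul_of_lt_of_le hT hP.le
  have hw : 1 < P * T ^ 2 := one_lt_mul_of_lt_of_le hP (one_lt_pow₀ hT two_ne_zero).le
  have hD : 1 < T ^ (4 * n + 2) * P ^ (2 * n + 3) :=
    one_lt_mul_of_lt_of_le (one_lt_pow₀ hT (by omega)) (one_lt_pow₀ hP (by omega)).le
  have s1 : ∑ j ∈ Finset.range n, T ^ (2 * (j + 1)) * P ^ j
      = T ^ 2 * ((P * T ^ 2) ^ n - 1) / (P * T ^ 2 - 1) := by
    rw [mul_div_assoc, ← geom_sum_eq hw.ne', Finset.mul_sum]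
    exact Finset.sum_congr rfl fun j _ ↦ by ring
  have s2 (N : ℕ) : ∑ b ∈ Finset.range (N + 1), (P⁻¹ * T⁻¹ ^ 2) ^ b
      = ((P * T ^ 2) ^ (N + 1) - 1) / ((P * T ^ 2) ^ N * (P * T ^ 2 - 1)) := by
    rw [show P⁻¹ * T⁻¹ ^ 2 = (P * T ^ 2)⁻¹ by rw [mul_inv, inv_pow]]
    generalize P * T ^ 2 = w at hw
    have h0 : w - 1 ≠ 0 := by linarith
    have h1 : w ≠ 0 := by linarith
    rw [geom_sum_inv hw.ne' h1, inv_pow]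
    field_simp
    ring
  have hJ' : J = (P - 1) * T / (T * P - 1) := by
    have h0 : T * P - 1 ≠ 0 := by linarith
    rw [eq_div_iff h0]
    field_simp at hJ
    linear_combination hJ
  rw [s2, s2, hJ'] at hZ
  rw [s1]
  have a1 : T * P - 1 ≠ 0 := by linarith
  have a2 : P * T ^ 2 - 1 ≠ 0 := by linarith
  have a3 : T ^ (4 * n + 2) * P ^ (2 * n + 3) - 1 ≠ 0 := by linarith
  rw [eq_div_iff (mul_ne_zero a3 a1)]
  have e1 : (P * T ^ 2) ^ n = P ^ n * (T ^ n) ^ 2 := by ring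
  have e2 : (P * T ^ 2) ^ (2 * n) = (P ^ n) ^ 2 * (T ^ n) ^ 4 := by ring
  have e3 : (P * T ^ 2) ^ (n + 1) = P ^ n * (T ^ n) ^ 2 * (P * T ^ 2) := by ring
  have e4 : (P * T ^ 2) ^ (2 * n + 1) = (P ^ n) ^ 2 * (T ^ n) ^ 4 * (P * T ^ 2) := by ring
  have e5 : T ^ (2 * n) = (T ^ n) ^ 2 := by ring
  have e6 : T ^ (2 * n + 1) = (T ^ n) ^ 2 * T := by ring
  have e7 : T ^ (4 * n + 2) = (T ^ n) ^ 4 * T ^ 2 := by ring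
  have e8 : P ^ (2 * n + 3) = (P ^ n) ^ 2 * P ^ 3 := by ring
  have e9 : T ^ (2 * (2 * n + 1)) = (T ^ n) ^ 4 * T ^ 2 := by ring
  simp only [e1, e2, e3, e4, e5, e6, e7, e8, e9, inv_pow, pow_add P n] at hZ ⊢
  have hA : 0 < T ^ n := by positivity
  have hB : 0 < P ^ n := by positivity
  generalize T ^ n = A at *
  generalize P ^ n = B at *
  have hP0 : P ≠ 0 := by linarith
  have hT0 : T ≠ 0 := by linarith
  rw [mul_comm T P] at *
  field_simp at hZ ⊢
  linear_combination hZ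

/-- The Igusa local zeta function of the `A_{2n}`-singularity `f(x,y) = y² − x^{2n+1}`. -/
theorem stmt_10 (p : ℕ) [Fact p.Prime] (hp : Odd p)
    [MeasurableSpace ℚ_[p]] [BorelSpace ℚ_[p]]
    (μ : Measure (ℚ_[p] × ℚ_[p])) [μ.IsAddHaarMeasure]
    (hμ : μ ({x : ℚ_[p] | ‖x‖ ≤ 1} ×ˢ {y : ℚ_[p] | ‖y‖ ≤ 1}) = 1)
    (n : ℕ) (hn : 1 ≤ n) (s : ℝ) (hs : 0 < s) :
    (∫ z in ({x : ℚ_[p] | ‖x‖ ≤ 1} ×ˢ {y : ℚ_[p] | ‖y‖ ≤ 1}),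
        ‖z.2 ^ 2 - z.1 ^ (2 * n + 1)‖ ^ s ∂μ)
      = ((p : ℝ) - 1) *
          (((p : ℝ) ^ (s + 1) - 1) * ((p : ℝ) ^ (2 * (n : ℝ) * s + (n : ℝ) + 1) + 1) *
              (∑ j ∈ Finset.Icc 1 n, (p : ℝ) ^ (2 * (j : ℝ) * s + (j : ℝ) - 1))
            + (p : ℝ) ^ ((2 * (n : ℝ) + 1) * s + (n : ℝ)) *
                ((p : ℝ) ^ ((2 * (n : ℝ) + 1) * s + (n : ℝ) + 1) * ((p : ℝ) ^ (s + 2) - 1)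
                  + (p : ℝ) ^ (s + 1) - 1)) /
          (((p : ℝ) ^ ((4 * (n : ℝ) + 2) * s + 2 * (n : ℝ) + 3) - 1)
            * ((p : ℝ) ^ (s + 1) - 1)) := by
  have hP : (1 : ℝ) < p := by exact_mod_cast (Fact.out : p.Prime).one_lt
  have hP0 : (0 : ℝ) < p := by linarith
  have hball : {x : ℚ_[p] | ‖x‖ ≤ 1} = closedBall 0 1 := by ext; simp
  rw [hball] at hμ ⊢
  set ν : Measure ℚ_[p] := Measure.addHaarMeasure (padicUnitBall p)
  have hν : ν (closedBall 0 1) = 1 := Measure.addHaarMeasure_self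
  have hμν : μ = ν.prod ν := by
    rw [eq_smul_of_apply_eq μ (ν.prod ν) (padicUnitBall p ×ˢ padicUnitBall p) 1, one_smul]
    change μ (closedBall 0 1 ×ˢ closedBall 0 1) = 1 * ν.prod ν (closedBall 0 1 ×ˢ closedBall 0 1)
    rw [hμ, Measure.prod_prod, hν, one_mul, one_mul]
  rw [hμν]
  have hrec := setIntegral_cusp_recurrence ν hν n hs rfl rfl rfl rfl
  have hJ := setIntegral_norm_rpow ν hν hs
  rw [Real.inv_rpow hP0.le] at hrec hJ
  rw [cusp_recurrence_solution hP (Real.one_lt_rpow hP hs) hJ hrec]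
  have hexp (a b : ℕ) : (p : ℝ) ^ ((a : ℝ) * s + b) = ((p : ℝ) ^ s) ^ a * (p : ℝ) ^ b := by
    rw [Real.rpow_add hP0, mul_comm (a : ℝ), Real.rpow_mul hP0.le, Real.rpow_natCast,
      Real.rpow_natCast]
  have h1 : (p : ℝ) ^ (s + 1) = (p : ℝ) ^ s * p := by simpa using hexp 1 1
  have h2 : (p : ℝ) ^ (s + 2) = (p : ℝ) ^ s * (p : ℝ) ^ 2 := by simpa using hexp 1 2
  have h3 : (p : ℝ) ^ (2 * (n : ℝ) * s + n + 1) = ((p : ℝ) ^ s) ^ (2 * n) * (p : ℝ) ^ (n + 1) := by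
    rw [← hexp]; push_cast; ring_nf
  have h4 : (p : ℝ) ^ ((2 * (n : ℝ) + 1) * s + n)
      = ((p : ℝ) ^ s) ^ (2 * n + 1) * (p : ℝ) ^ n := by
    rw [← hexp]; push_cast; ring_nf
  have h5 : (p : ℝ) ^ ((2 * (n : ℝ) + 1) * s + n + 1)
      = ((p : ℝ) ^ s) ^ (2 * n + 1) * (p : ℝ) ^ (n + 1) := by
    rw [← hexp]; push_cast; ring_nf
  have h6 : (p : ℝ) ^ ((4 * (n : ℝ) + 2) * s + 2 * n + 3)
      = ((p : ℝ) ^ s) ^ (4 * n + 2) * (p : ℝ) ^ (2 * n + 3) := by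
    rw [← hexp]; push_cast; ring_nf
  have h7 : ∑ j ∈ Finset.Icc 1 n, (p : ℝ) ^ (2 * (j : ℝ) * s + j - 1)
      = ∑ j ∈ Finset.range n, ((p : ℝ) ^ s) ^ (2 * (j + 1)) * (p : ℝ) ^ j := by
    rw [← Finset.Ico_add_one_right_eq_Icc, Finset.sum_Ico_eq_sum_range]
    refine Finset.sum_congr rfl fun j _ ↦ ?_
    rw [← hexp]; push_cast; ring_nf
  rw [h1, h2, h3, h4, h5, h6, h7]
end

section
/- Let p be an odd prime, let n ≥ 1 be an integer, and let s > 0 be real. Let μ be the Haar measure on ℚ_p² normalized so that μ(ℤ_p²) = 1. Then ∫_{ℤ_p²} |x y² − x^{2n+2}|_p^s dμ(x,y) = (p−1) · [ p^{(2n+2)s+n}(p^{s+1} − 1) + (p−1) p^{(4n+4)s+2n+1}(p^{s+1} + 1) + (p−1) p^{3s} (p^{(2n+1)s+n+1} + 1) · Σ_{j=0}^{n−1} p^{2js+j} ] / [ (p^{s+1} − 1)(p^{(4n+4)s+2n+3} − 1) ]. -/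
open MeasureTheory Metric

namespace PadicIgusa

variable {p : ℕ} [Fact p.Prime]

lemma norm_p_mul (x : ℚ_[p]) : ‖(p : ℚ_[p]) * x‖ = (p : ℝ)⁻¹ * ‖x‖ := by
  rw [norm_mul, Padic.norm_p]

lemma norm_p_mul_lt_one_iff (x : ℚ_[p]) : ‖(p : ℚ_[p]) * x‖ < 1 ↔ ‖x‖ ≤ 1 := by
  have hp : (0 : ℝ) < p := by exact_mod_cast (Fact.out : p.Prime).pos
  have h := Padic.norm_le_pow_iff_norm_lt_pow_add_one x 0
  simp only [zpow_zero, zero_add, zpow_one] at h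
  rw [h, norm_p_mul, inv_mul_lt_iff₀ hp, mul_one]

lemma preimage_p_mul_ball :
    (fun x : ℚ_[p] => (p : ℚ_[p]) * x) ⁻¹' ball 0 1 = closedBall 0 1 := by
  ext x
  simp only [Set.mem_preimage, mem_ball_zero_iff, mem_closedBall_zero_iff, norm_p_mul_lt_one_iff]

lemma preimage_unit_mul_closedBall {c : ℚ_[p]} (hc : ‖c‖ = 1) :
    (fun x : ℚ_[p] => c * x) ⁻¹' closedBall 0 1 = closedBall 0 1 := by
  ext x
  simp [hc]

lemma preimage_sub_closedBall {z : ℚ_[p]} (hz : ‖z‖ ≤ 1) :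
    (fun x : ℚ_[p] => x - z) ⁻¹' closedBall 0 1 = closedBall 0 1 := by
  ext x
  simp only [Set.mem_preimage, mem_closedBall_zero_iff]
  constructor <;> intro h
  · rw [← sub_add_cancel x z]
    exact (IsUltrametricDist.norm_add_le_max _ z).trans (max_le h hz)
  · rw [sub_eq_add_neg]
    exact (IsUltrametricDist.norm_add_le_max _ _).trans (max_le h (by rwa [norm_neg]))

lemma closedBall_eq_iUnion :
    closedBall (0 : ℚ_[p]) 1 = ⋃ r ∈ Finset.range p, ball (r : ℚ_[p]) 1 := by
  ext x
  simp only [Set.mem_iUnion, mem_closedBall_zero_iff, mem_ball, dist_eq_norm, Finset.mem_range,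
    exists_prop]
  constructor
  · intro hx
    obtain ⟨x, rfl⟩ : ∃ z : ℤ_[p], (z : ℚ_[p]) = x := ⟨⟨x, hx⟩, rfl⟩
    obtain ⟨r, hr, h⟩ := PadicInt.exists_mem_range x
    rw [PadicInt.maximalIdeal_eq_span_p, Ideal.mem_span_singleton,
      ← PadicInt.norm_lt_one_iff_dvd] at h
    exact ⟨r, hr, by simpa [PadicInt.norm_def] using h⟩
  · rintro ⟨r, -, h⟩
    have := IsUltrametricDist.norm_add_le_max (x - r) (r : ℚ_[p])
    rw [sub_add_cancel] at this
    exact this.trans (max_le h.le (by simpa using Padic.norm_int_le_one (p := p) r))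

lemma pairwiseDisjoint_ball :
    ((Finset.range p : Finset ℕ) : Set ℕ).PairwiseDisjoint fun r => ball (r : ℚ_[p]) 1 := by
  intro a ha b hb hab
  simp only [Finset.coe_range, Set.mem_Iio] at ha hb
  refine (IsUltrametricDist.ball_eq_or_disjoint _ _ _).resolve_left fun h => hab ?_
  have h1 : (a : ℚ_[p]) ∈ ball (b : ℚ_[p]) 1 := h ▸ mem_ball_self one_pos
  rw [mem_ball, dist_eq_norm] at h1
  have h2 : ‖(((a : ℤ) - (b : ℤ) : ℤ) : ℚ_[p])‖ < 1 := by simpa using h1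
  rw [Padic.norm_intCast_lt_one_iff] at h2
  have := Int.eq_zero_of_abs_lt_dvd h2 (by rw [abs_lt]; omega)
  omega

lemma norm_p_pow_mul_rpow (k : ℕ) (x : ℚ_[p]) (s : ℝ) :
    ‖(p : ℚ_[p]) ^ k * x‖ ^ s = ((p : ℝ) ^ s)⁻¹ ^ k * ‖x‖ ^ s := by
  rw [norm_mul, norm_pow, Padic.norm_p, Real.mul_rpow (by positivity) (norm_nonneg _),
    ← Real.rpow_pow_comm (by positivity), Real.inv_rpow (by positivity)]

lemma norm_sub_eq_left {a b : ℚ_[p]} (h : ‖b‖ < ‖a‖) : ‖a - b‖ = ‖a‖ := by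
  have := IsUltrametricDist.norm_add_eq_max_of_norm_ne_norm (x := a) (y := -b)
    (by rw [norm_neg]; exact h.ne')
  rw [sub_eq_add_neg, this, norm_neg, max_eq_left h.le]

lemma norm_sub_eq_right {a b : ℚ_[p]} (h : ‖a‖ < ‖b‖) : ‖a - b‖ = ‖b‖ := by
  rw [norm_sub_rev, norm_sub_eq_left h]

lemma continuous_norm_rpow {X : Type*} [TopologicalSpace X] {f : X → ℚ_[p]} (hf : Continuous f)
    {s : ℝ} (hs : 0 < s) : Continuous fun x => ‖f x‖ ^ s :=
  hf.norm.rpow_const fun _ => .inr hs.le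

variable [MeasurableSpace ℚ_[p]] {ν : Measure ℚ_[p]}

lemma measureReal_closedBall (hν : ν (closedBall 0 1) = 1) :
    ν.real (closedBall (0 : ℚ_[p]) 1) = 1 := by simp [Measure.real, hν]

variable [BorelSpace ℚ_[p]] [ν.IsAddHaarMeasure]

lemma p_mul_measure_ball (hν : ν (closedBall 0 1) = 1) : p * ν (ball 0 1) = 1 := by
  rw [← hν, closedBall_eq_iUnion,
    measure_biUnion_finset pairwiseDisjoint_ball fun _ _ => measurableSet_ball]
  simp [Measure.addHaar_ball_center]

lemma map_mul_eq_smul {c : ℚ_[p]} (hc : c ≠ 0) : ∃ k : NNReal, ν.map (c * ·) = k • ν := by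
  have : (ν.map (c * ·)).IsAddHaarMeasure :=
    ν.isAddHaarMeasure_map (AddMonoidHom.mulLeft c) (continuous_const_mul c)
      (mul_left_surjective₀ hc) (Homeomorph.mulLeft₀ c hc).isClosedEmbedding.tendsto_cocompact
  exact ⟨_, Measure.isAddLeftInvariant_eq_smul _ _⟩

lemma map_p_mul (hν : ν (closedBall 0 1) = 1) : ν.map ((p : ℚ_[p]) * ·) = (p : NNReal) • ν := by
  have hp : (p : ℚ_[p]) ≠ 0 := by exact_mod_cast (Fact.out : p.Prime).ne_zero
  obtain ⟨k, hk⟩ := map_mul_eq_smul (ν := ν) hp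
  have h := congrArg (fun m : Measure ℚ_[p] => m (ball 0 1)) hk
  simp only [Measure.smul_apply] at h
  rw [Measure.map_apply (by fun_prop) measurableSet_ball, preimage_p_mul_ball, hν,
    ← p_mul_measure_ball hν] at h
  have h0 : ν (ball 0 1) ≠ 0 := (measure_ball_pos ν 0 one_pos).ne'
  have h1 : ν (ball 0 1) ≠ ⊤ := measure_ball_lt_top.ne
  rw [ENNReal.smul_def, smul_eq_mul, ENNReal.mul_left_inj h0 h1] at h
  rw [hk]
  congr 1
  exact_mod_cast h.symm

lemma map_unit_mul (hν : ν (closedBall 0 1) = 1) {c : ℚ_[p]} (hc : ‖c‖ = 1) :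
    ν.map (c * ·) = ν := by
  obtain ⟨k, hk⟩ := map_mul_eq_smul (ν := ν) (norm_pos_iff.1 (hc ▸ one_pos))
  have h := congrArg (fun m : Measure ℚ_[p] => m (closedBall 0 1)) hk
  simp only [Measure.smul_apply] at h
  rw [Measure.map_apply (by fun_prop) measurableSet_closedBall, preimage_unit_mul_closedBall hc, hν,
    ENNReal.smul_def, smul_eq_mul, mul_one] at h
  rw [hk, show k = 1 by exact_mod_cast h.symm, one_smul]

lemma setIntegral_ball (hν : ν (closedBall 0 1) = 1) {g : ℚ_[p] → ℝ} (hg : Continuous g) :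
    ∫ x in ball 0 1, g x ∂ν = (p : ℝ)⁻¹ * ∫ x in closedBall 0 1, g (p * x) ∂ν := by
  have hp : (p : ℝ) ≠ 0 := by exact_mod_cast (Fact.out : p.Prime).ne_zero
  have h := setIntegral_map (μ := ν) (g := ((p : ℚ_[p]) * ·)) (f := g)
    (measurableSet_ball (x := (0 : ℚ_[p])) (ε := 1)) hg.aestronglyMeasurable
    (by fun_prop)
  rw [preimage_p_mul_ball, map_p_mul hν, Measure.restrict_smul, integral_smul_nnreal_measure] at h
  rw [← h, NNReal.smul_def, smul_eq_mul, NNReal.coe_natCast, inv_mul_cancel_left₀ hp]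

lemma setIntegral_unit_mul (hν : ν (closedBall 0 1) = 1) {g : ℚ_[p] → ℝ} (hg : Continuous g)
    {c : ℚ_[p]} (hc : ‖c‖ = 1) :
    ∫ x in closedBall 0 1, g (c * x) ∂ν = ∫ x in closedBall 0 1, g x ∂ν := by
  have h := setIntegral_map (μ := ν) (g := (c * ·)) (f := g)
    (measurableSet_closedBall (x := (0 : ℚ_[p])) (ε := 1)) hg.aestronglyMeasurable (by fun_prop)
  rw [preimage_unit_mul_closedBall hc, map_unit_mul hν hc] at h
  exact h.symm

lemma setIntegral_sub {g : ℚ_[p] → ℝ} (hg : Continuous g) {z : ℚ_[p]} (hz : ‖z‖ ≤ 1) :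
    ∫ x in closedBall 0 1, g (x - z) ∂ν = ∫ x in closedBall 0 1, g x ∂ν := by
  have h := setIntegral_map (μ := ν) (g := (· - z)) (f := g)
    (measurableSet_closedBall (x := (0 : ℚ_[p])) (ε := 1)) hg.aestronglyMeasurable (by fun_prop)
  rw [preimage_sub_closedBall hz, map_sub_right_eq_self] at h
  exact h.symm

lemma setIntegral_closedBall {g : ℚ_[p] → ℝ} (hg : Continuous g) :
    ∫ x in closedBall 0 1, g x ∂ν = (∫ x in sphere 0 1, g x ∂ν) + ∫ x in ball 0 1, g x ∂ν := by
  have hi := hg.continuousOn.integrableOn_compact (μ := ν) (isCompact_closedBall (0 : ℚ_[p]) 1)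
  rw [← sphere_union_ball, setIntegral_union sphere_disjoint_ball measurableSet_ball
    (hi.mono_set sphere_subset_closedBall) (hi.mono_set ball_subset_closedBall)]

lemma setIntegral_closedBall_eq_add (hν : ν (closedBall 0 1) = 1) {g : ℚ_[p] → ℝ}
    (hg : Continuous g) : ∫ x in closedBall 0 1, g x ∂ν =
      (∫ x in sphere 0 1, g x ∂ν) + (p : ℝ)⁻¹ * ∫ x in closedBall 0 1, g (p * x) ∂ν := by
  rw [setIntegral_closedBall hg, setIntegral_ball hν hg]

lemma setIntegral_closedBall_eq_sum (hν : ν (closedBall 0 1) = 1) {g : ℚ_[p] → ℝ}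
    (hg : Continuous g) (N : ℕ) : ∫ x in closedBall 0 1, g x ∂ν =
      (∑ j ∈ Finset.range N, (p : ℝ)⁻¹ ^ j * ∫ x in sphere 0 1, g (p ^ j * x) ∂ν) +
        (p : ℝ)⁻¹ ^ N * ∫ x in closedBall 0 1, g (p ^ N * x) ∂ν := by
  induction N with
  | zero => simp
  | succ N ih =>
    rw [ih, setIntegral_closedBall_eq_add hν (g := fun x => g (p ^ N * x)) (by fun_prop),
      Finset.sum_range_succ]
    simp only [pow_succ, mul_assoc]
    ring

lemma measureReal_sphere (hν : ν (closedBall 0 1) = 1) :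
    ν.real (sphere (0 : ℚ_[p]) 1) = 1 - (p : ℝ)⁻¹ := by
  have h := setIntegral_closedBall_eq_add hν (g := fun _ => (1 : ℝ)) continuous_const
  simp only [setIntegral_const, smul_eq_mul, mul_one] at h
  rw [measureReal_closedBall hν] at h
  linarith

lemma setIntegral_sphere_of_eq (hν : ν (closedBall 0 1) = 1) {g : ℚ_[p] → ℝ} {c : ℝ}
    (hg : ∀ x, ‖x‖ = 1 → g x = c) : ∫ x in sphere 0 1, g x ∂ν = (1 - (p : ℝ)⁻¹) * c := by
  rw [setIntegral_congr_fun (g := fun _ => c) isClosed_sphere.measurableSet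
    (fun x hx => hg x (by simpa using hx)), setIntegral_const, measureReal_sphere hν, smul_eq_mul]

lemma setIntegral_norm_rpow (hν : ν (closedBall 0 1) = 1) {s : ℝ} (hs : 0 < s) :
    (∫ x in closedBall (0 : ℚ_[p]) 1, ‖x‖ ^ s ∂ν) * (1 - (p : ℝ)⁻¹ * ((p : ℝ) ^ s)⁻¹) =
      1 - (p : ℝ)⁻¹ := by
  have h := setIntegral_closedBall_eq_add hν
    (g := fun x => ‖x‖ ^ s) (continuous_norm.rpow_const fun _ => .inr hs.le)
  have h1 : ∀ x : ℚ_[p], ‖(p : ℚ_[p]) * x‖ ^ s = ((p : ℝ) ^ s)⁻¹ * ‖x‖ ^ s := fun x => by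
    simpa using norm_p_pow_mul_rpow 1 x s
  simp only [h1] at h
  rw [setIntegral_sphere_of_eq hν (c := 1) (fun x hx => by simp [hx]), integral_const_mul] at h
  linarith

lemma setIntegral_sphere_sub {s : ℝ} (hs : 0 < s) {z : ℚ_[p]}
    (hz : ‖z‖ ≤ 1) :
    ∫ x in sphere 0 1, ‖x - z‖ ^ s ∂ν =
      (∫ x in closedBall (0 : ℚ_[p]) 1, ‖x‖ ^ s ∂ν) - ∫ x in ball 0 1, ‖x - z‖ ^ s ∂ν := by
  rw [← setIntegral_sub (g := fun x => ‖x‖ ^ s) (continuous_norm_rpow continuous_id hs) hz,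
    setIntegral_closedBall (continuous_norm_rpow (by fun_prop) hs)]
  simp

lemma measureReal_ball (hν : ν (closedBall 0 1) = 1) :
    ν.real (ball (0 : ℚ_[p]) 1) = (p : ℝ)⁻¹ := by
  have h := congrArg ENNReal.toReal (p_mul_measure_ball hν)
  rw [ENNReal.toReal_mul, ENNReal.toReal_natCast, ENNReal.toReal_one] at h
  exact eq_inv_of_mul_eq_one_right h

lemma setIntegral_sphere_sub_sq (hν : ν (closedBall 0 1) = 1) {s : ℝ} (hs : 0 < s) :
    ∫ x in sphere (0 : ℚ_[p]) 1, ∫ z in closedBall (0 : ℚ_[p]) 1, ‖z ^ 2 - x‖ ^ s ∂ν ∂ν =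
      (1 - (p : ℝ)⁻¹) * ∫ x in closedBall (0 : ℚ_[p]) 1, ‖x‖ ^ s ∂ν := by
  set A := ∫ x in closedBall (0 : ℚ_[p]) 1, ‖x‖ ^ s ∂ν with hA
  have hint : Integrable (Function.uncurry fun x z : ℚ_[p] => ‖z ^ 2 - x‖ ^ s)
      ((ν.restrict (sphere 0 1)).prod (ν.restrict (closedBall 0 1))) := by
    rw [Measure.prod_restrict]
    exact (continuous_norm_rpow (by fun_prop) hs).continuousOn.integrableOn_compact
      ((isCompact_sphere _ _).prod (isCompact_closedBall _ _))
  have hcont : Continuous fun z : ℚ_[p] => ∫ x in sphere 0 1, ‖z ^ 2 - x‖ ^ s ∂ν :=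
    continuous_parametric_integral_of_continuous
      (continuous_norm_rpow (f := fun w : ℚ_[p] × ℚ_[p] => w.1 ^ 2 - w.2) (by fun_prop) hs)
      (isCompact_sphere _ _)
  rw [integral_integral_swap hint, setIntegral_closedBall hcont]
  have h1 : ∫ z in sphere (0 : ℚ_[p]) 1, ∫ x in sphere (0 : ℚ_[p]) 1, ‖z ^ 2 - x‖ ^ s ∂ν ∂ν =
      (1 - (p : ℝ)⁻¹) * (A - (p : ℝ)⁻¹) := by
    refine setIntegral_sphere_of_eq hν fun z hz => ?_
    simp only [norm_sub_rev (z ^ 2)]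
    rw [setIntegral_sphere_sub hs (by simp [hz]), ← hA]
    rw [setIntegral_congr_fun (g := fun _ => (1 : ℝ)) measurableSet_ball, setIntegral_const,
      measureReal_ball hν, smul_eq_mul, mul_one]
    intro x hx
    rw [mem_ball_zero_iff] at hx
    simp only
    rw [norm_sub_eq_right (by simpa [hz] using hx)]
    simp [hz]
  have h2 : ∫ z in ball (0 : ℚ_[p]) 1, ∫ x in sphere (0 : ℚ_[p]) 1, ‖z ^ 2 - x‖ ^ s ∂ν ∂ν =
      (p : ℝ)⁻¹ * (1 - (p : ℝ)⁻¹) := by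
    rw [setIntegral_congr_fun (g := fun _ => 1 - (p : ℝ)⁻¹) measurableSet_ball, setIntegral_const,
      measureReal_ball hν, smul_eq_mul]
    intro z hz
    rw [mem_ball_zero_iff] at hz
    simp only
    rw [setIntegral_sphere_of_eq hν (c := 1), mul_one]
    intro x hx
    rw [norm_sub_eq_right, hx, Real.one_rpow]
    rw [hx, norm_pow]
    exact pow_lt_one₀ (norm_nonneg _) hz two_ne_zero
  rw [h1, h2]
  ring

/-- The inner integral `∫_{ℤ_p} |x y² - x^{2n+2}|^s dy`. -/
noncomputable def fiberIntegral (ν : Measure ℚ_[p]) (n : ℕ) (s : ℝ) (x : ℚ_[p]) : ℝ :=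
  ∫ y in closedBall (0 : ℚ_[p]) 1, ‖x * y ^ 2 - x ^ (2 * n + 2)‖ ^ s ∂ν

lemma continuous_fiberIntegral (n : ℕ) {s : ℝ} (hs : 0 < s) :
    Continuous (fiberIntegral ν n s) :=
  continuous_parametric_integral_of_continuous
    (continuous_norm_rpow
      (f := fun w : ℚ_[p] × ℚ_[p] => w.1 * w.2 ^ 2 - w.1 ^ (2 * n + 2)) (by fun_prop) hs)
    (isCompact_closedBall _ _)

lemma setIntegral_sphere_fiberIntegral (hν : ν (closedBall 0 1) = 1) (n : ℕ) {s : ℝ}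
    (hs : 0 < s) : ∫ x in sphere 0 1, fiberIntegral ν n s x ∂ν =
      (1 - (p : ℝ)⁻¹) * ∫ x in closedBall (0 : ℚ_[p]) 1, ‖x‖ ^ s ∂ν := by
  rw [← setIntegral_sphere_sub_sq hν hs]
  refine setIntegral_congr_fun isClosed_sphere.measurableSet fun x hx => ?_
  rw [mem_sphere_zero_iff_norm] at hx
  simp only [fiberIntegral]
  rw [← setIntegral_unit_mul hν (continuous_norm_rpow (by fun_prop) hs)
    (c := x ^ n) (by simp [hx])]
  congr with y
  rw [show x * (x ^ n * y) ^ 2 - x ^ (2 * n + 2) = x ^ (2 * n + 1) * (y ^ 2 - x) by ring,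
    norm_mul, norm_pow, hx, one_pow, one_mul]

lemma fiberIntegral_p_mul (hν : ν (closedBall 0 1) = 1) (n : ℕ) {s : ℝ} (hs : 0 < s)
    {x : ℚ_[p]} (hx : ‖x‖ = 1) :
    fiberIntegral ν n s (p * x) =
      (∑ j ∈ Finset.range (n + 1),
        (p : ℝ)⁻¹ ^ j * ((1 - (p : ℝ)⁻¹) * ((p : ℝ) ^ s)⁻¹ ^ (2 * j + 1))) +
      (p : ℝ)⁻¹ ^ (n + 1) * ((p : ℝ) ^ s)⁻¹ ^ (2 * n + 2) := by
  rw [fiberIntegral, setIntegral_closedBall_eq_sum hν (continuous_norm_rpow (by fun_prop) hs)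
    (n + 1)]
  congr 1
  · refine Finset.sum_congr rfl fun j hj => ?_
    congr 1
    refine setIntegral_sphere_of_eq hν fun y hy => ?_
    obtain ⟨k, hk⟩ : ∃ k, 2 * n + 2 = (2 * j + 1) + k + 1 :=
      ⟨2 * n - 2 * j, by have := Finset.mem_range.1 hj; omega⟩
    rw [hk, show (p : ℚ_[p]) * x * (p ^ j * y) ^ 2 - (p * x) ^ (2 * j + 1 + k + 1) =
      p ^ (2 * j + 1) * (x * y ^ 2 - p * (p ^ k * x ^ (2 * j + 1 + k + 1))) by ring,
      norm_p_pow_mul_rpow, norm_sub_eq_left]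
    · simp [hx, hy]
    · rw [norm_mul x, hx, norm_pow, hy, one_pow, one_mul]
      refine (norm_p_mul_lt_one_iff _).2 ?_
      rw [norm_mul, norm_pow x, hx, one_pow, mul_one, norm_pow]
      exact pow_le_one₀ (norm_nonneg _) Padic.norm_p_lt_one.le
  · congr 1
    rw [setIntegral_congr_fun (g := fun _ => ((p : ℝ) ^ s)⁻¹ ^ (2 * n + 2))
      measurableSet_closedBall, setIntegral_const, measureReal_closedBall hν, one_smul]
    intro y hy
    rw [mem_closedBall_zero_iff] at hy
    simp only
    rw [show (p : ℚ_[p]) * x * (p ^ (n + 1) * y) ^ 2 - (p * x) ^ (2 * n + 2) =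
      p ^ (2 * n + 2) * (p * (x * y ^ 2) - x ^ (2 * n + 2)) by ring,
      norm_p_pow_mul_rpow, norm_sub_eq_right]
    · simp [hx]
    · rw [norm_pow x, hx, one_pow]
      refine (norm_p_mul_lt_one_iff _).2 ?_
      rw [norm_mul, hx, one_mul, norm_pow]
      exact pow_le_one₀ (norm_nonneg _) hy

lemma fiberIntegral_p_sq_mul (hν : ν (closedBall 0 1) = 1) (n : ℕ) {s : ℝ} (hs : 0 < s)
    {x : ℚ_[p]} (hx : ‖x‖ ≤ 1) :
    fiberIntegral ν n s (p ^ 2 * x) =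
      (∑ j ∈ Finset.range (2 * n + 1),
        (p : ℝ)⁻¹ ^ j * ((1 - (p : ℝ)⁻¹) * ((p : ℝ) ^ s)⁻¹ ^ (2 * j + 2))) * ‖x‖ ^ s +
      (p : ℝ)⁻¹ ^ (2 * n + 1) * ((p : ℝ) ^ s)⁻¹ ^ (4 * n + 4) * fiberIntegral ν n s x := by
  rw [fiberIntegral, setIntegral_closedBall_eq_sum hν (continuous_norm_rpow (by fun_prop) hs)
    (2 * n + 1), Finset.sum_mul]
  congr 1
  · refine Finset.sum_congr rfl fun j hj => ?_
    rw [mul_assoc]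
    congr 1
    rw [mul_assoc]
    refine setIntegral_sphere_of_eq hν fun y hy => ?_
    obtain ⟨k, hk⟩ : ∃ k, 4 * n + 4 = (2 * j + 2) + 1 + k :=
      ⟨4 * n + 1 - 2 * j, by have := Finset.mem_range.1 hj; omega⟩
    rw [show (p : ℚ_[p]) ^ 2 * x * (p ^ j * y) ^ 2 - (p ^ 2 * x) ^ (2 * n + 2) =
        p ^ (2 * j + 2) * x * y ^ 2 - p ^ (4 * n + 4) * x ^ (2 * n + 2) by ring, hk,
      show (p : ℚ_[p]) ^ (2 * j + 2) * x * y ^ 2 - p ^ (2 * j + 2 + 1 + k) * x ^ (2 * n + 2) =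
        p ^ (2 * j + 2) * (x * (y ^ 2 - p * (p ^ k * x ^ (2 * n + 1)))) by ring,
      norm_p_pow_mul_rpow, norm_mul x, norm_sub_eq_left]
    · simp [hy]
    · rw [norm_pow y, hy, one_pow]
      refine (norm_p_mul_lt_one_iff _).2 ?_
      rw [norm_mul, norm_pow, norm_pow]
      exact mul_le_one₀ (pow_le_one₀ (norm_nonneg _) Padic.norm_p_lt_one.le)
        (by positivity) (pow_le_one₀ (norm_nonneg _) hx)
  · have key (y : ℚ_[p]) :
        ‖(p : ℚ_[p]) ^ 2 * x * (p ^ (2 * n + 1) * y) ^ 2 - (p ^ 2 * x) ^ (2 * n + 2)‖ ^ s =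
          ((p : ℝ) ^ s)⁻¹ ^ (4 * n + 4) * ‖x * y ^ 2 - x ^ (2 * n + 2)‖ ^ s := by
      rw [← norm_p_pow_mul_rpow]
      ring_nf
    simp only [key, integral_const_mul, fiberIntegral]
    ring

lemma setIntegral_fiberIntegral (hν : ν (closedBall 0 1) = 1) (n : ℕ) {s : ℝ} (hs : 0 < s) :
    ∫ x in closedBall 0 1, fiberIntegral ν n s x ∂ν =
      (1 - (p : ℝ)⁻¹) * (∫ x in closedBall (0 : ℚ_[p]) 1, ‖x‖ ^ s ∂ν) +
      (p : ℝ)⁻¹ * ((1 - (p : ℝ)⁻¹) *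
        ((∑ j ∈ Finset.range (n + 1),
          (p : ℝ)⁻¹ ^ j * ((1 - (p : ℝ)⁻¹) * ((p : ℝ) ^ s)⁻¹ ^ (2 * j + 1))) +
        (p : ℝ)⁻¹ ^ (n + 1) * ((p : ℝ) ^ s)⁻¹ ^ (2 * n + 2))) +
      (p : ℝ)⁻¹ ^ 2 *
        ((∑ j ∈ Finset.range (2 * n + 1),
          (p : ℝ)⁻¹ ^ j * ((1 - (p : ℝ)⁻¹) * ((p : ℝ) ^ s)⁻¹ ^ (2 * j + 2))) *
          (∫ x in closedBall (0 : ℚ_[p]) 1, ‖x‖ ^ s ∂ν) +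
        (p : ℝ)⁻¹ ^ (2 * n + 1) * ((p : ℝ) ^ s)⁻¹ ^ (4 * n + 4) *
          ∫ x in closedBall 0 1, fiberIntegral ν n s x ∂ν) := by
  have hc := continuous_fiberIntegral (ν := ν) n hs
  conv_lhs => rw [setIntegral_closedBall_eq_sum hν hc 2]
  simp only [Finset.sum_range_succ, Finset.sum_range_zero, zero_add, pow_zero, one_mul, pow_one]
  rw [setIntegral_sphere_fiberIntegral hν n hs,
    setIntegral_sphere_of_eq hν fun x hx => fiberIntegral_p_mul hν n hs hx,
    setIntegral_congr_fun (f := fun x => fiberIntegral ν n s (p ^ 2 * x)) measurableSet_closedBall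
      fun x hx => fiberIntegral_p_sq_mul hν n hs (mem_closedBall_zero_iff.1 hx), integral_add, integral_const_mul, integral_const_mul]
  · simp only [Finset.sum_range_succ]
  · exact ((continuous_norm_rpow continuous_id hs).const_mul _).continuousOn.integrableOn_compact
      (isCompact_closedBall _ _)
  · exact (hc.const_mul _).continuousOn.integrableOn_compact (isCompact_closedBall _ _)

lemma sum_range_inv_pow {P T : ℝ} (hP : 1 < P) (hT : 1 < T) (N c : ℕ) :
    ∑ j ∈ Finset.range N, P⁻¹ ^ j * ((1 - P⁻¹) * T⁻¹ ^ (2 * j + c)) =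
      (P - 1) * T * T * ((P * T ^ 2) ^ N - 1) /
        (T ^ c * (P * T ^ 2) ^ N * (P * T ^ 2 - 1)) := by
  have hr : 1 < P * T ^ 2 := one_lt_mul_of_lt_of_le hP (one_le_pow₀ hT.le)
  have hr' : P * T ^ 2 - 1 ≠ 0 := by linarith
  have hP0 : P ≠ 0 := by positivity
  have hT0 : T ≠ 0 := by positivity
  induction N with
  | zero => simp
  | succ N ih =>
    rw [Finset.sum_range_succ, ih]
    simp only [inv_pow, pow_succ, pow_add, pow_mul, mul_pow]
    field_simp
    ring

lemma eq_of_recursion {P T A I : ℝ} (hP : 1 < P) (hT : 1 < T) (n : ℕ)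
    (hA : A * (1 - P⁻¹ * T⁻¹) = 1 - P⁻¹)
    (hI : I = (1 - P⁻¹) * A +
      P⁻¹ * ((1 - P⁻¹) *
        ((∑ j ∈ Finset.range (n + 1), P⁻¹ ^ j * ((1 - P⁻¹) * T⁻¹ ^ (2 * j + 1))) +
        P⁻¹ ^ (n + 1) * T⁻¹ ^ (2 * n + 2))) +
      P⁻¹ ^ 2 *
        ((∑ j ∈ Finset.range (2 * n + 1), P⁻¹ ^ j * ((1 - P⁻¹) * T⁻¹ ^ (2 * j + 2))) * A +
        P⁻¹ ^ (2 * n + 1) * T⁻¹ ^ (4 * n + 4) * I)) :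
    I = (P - 1) *
      ((P * T ^ 2) ^ n * T ^ 2 * (T * P - 1) +
        (P - 1) * ((P * T ^ 2) ^ n * (P * T ^ 2) ^ n * P * T ^ 4) * (T * P + 1) +
        (P - 1) * T ^ 3 * ((P * T ^ 2) ^ n * T * P + 1) *
          ∑ j ∈ Finset.range n, (P * T ^ 2) ^ j) /
      ((T * P - 1) * ((P * T ^ 2) ^ n * (P * T ^ 2) ^ n * P ^ 3 * T ^ 4 - 1)) := by
  have hP0 : P ≠ 0 := by positivity
  have hT0 : T ≠ 0 := by positivity
  have hr : 1 < P * T ^ 2 := one_lt_mul_of_lt_of_le hP (one_le_pow₀ hT.le)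
  have hr' : P * T ^ 2 - 1 ≠ 0 := by linarith
  have hTP : T * P - 1 ≠ 0 := by nlinarith
  have hPT : P * T - 1 ≠ 0 := by rwa [mul_comm]
  have hA' : A = (P - 1) * T / (T * P - 1) := by
    rw [eq_div_iff hTP]
    field_simp at hA
    linarith
  have hR : (P * T ^ 2) ^ n = P ^ n * (T ^ 2) ^ n := mul_pow ..
  have hR1 : 1 ≤ (P * T ^ 2) ^ n := one_le_pow₀ hr.le
  set R := (P * T ^ 2) ^ n with hRdef
  have hR0 : R ≠ 0 := by positivity
  have hD : 1 < R * R * P ^ 3 * T ^ 4 := by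
    have h1 : 1 ≤ R * R := one_le_mul_of_one_le_of_one_le hR1 hR1
    have h2 : 1 < R * R * P ^ 3 := one_lt_mul_of_le_of_lt h1 (one_lt_pow₀ hP (by norm_num))
    exact one_lt_mul_of_lt_of_le h2 (one_le_pow₀ hT.le)
  have hD' : R * R * P ^ 3 * T ^ 4 - 1 ≠ 0 := by linarith
  have e1 : P⁻¹ ^ (n + 1) * T⁻¹ ^ (2 * n + 2) = (R * P * T ^ 2)⁻¹ := by
    rw [hR, pow_succ, pow_add T⁻¹, pow_mul]
    simp only [inv_pow, mul_inv]
    ring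
  have e2 : P⁻¹ ^ (2 * n + 1) * T⁻¹ ^ (4 * n + 4) = (R * R * P * T ^ 4)⁻¹ := by
    rw [hR, show 4 * n + 4 = 2 * n + 2 * n + 4 by ring, show 2 * n + 1 = n + n + 1 by ring]
    simp only [pow_add, pow_mul, inv_pow, mul_inv, pow_one]
    ring
  have e3 : (P * T ^ 2) ^ (n + 1) = R * (P * T ^ 2) := pow_succ ..
  have e4 : (P * T ^ 2) ^ (2 * n + 1) = R * R * (P * T ^ 2) := by
    rw [pow_succ, two_mul, pow_add]
  rw [sum_range_inv_pow hP hT, sum_range_inv_pow hP hT, e1, e2, e3, e4] at hI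
  rw [geom_sum_eq hr.ne', ← hRdef, eq_div_iff (mul_ne_zero hTP hD')]
  clear_value R
  subst hA'
  field_simp at hI ⊢
  linear_combination hI

lemma exists_isAddHaarMeasure_prod_eq (μ : Measure (ℚ_[p] × ℚ_[p])) [μ.IsAddHaarMeasure]
    (hμ : μ (closedBall 0 1 ×ˢ closedBall 0 1) = 1) :
    ∃ ν : Measure ℚ_[p], ν.IsAddHaarMeasure ∧ ν (closedBall 0 1) = 1 ∧ μ = ν.prod ν := by
  let K : TopologicalSpace.PositiveCompacts ℚ_[p] :=
    ⟨⟨closedBall 0 1, isCompact_closedBall _ _⟩,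
      ⟨0, ball_subset_interior_closedBall (mem_ball_self one_pos)⟩⟩
  have hν : Measure.addHaarMeasure K (closedBall 0 1) = 1 := Measure.addHaarMeasure_self
  refine ⟨Measure.addHaarMeasure K, inferInstance, hν, ?_⟩
  obtain ⟨k, h⟩ : ∃ k : NNReal,
      μ = k • (Measure.addHaarMeasure K).prod (Measure.addHaarMeasure K) :=
    ⟨_, Measure.isAddLeftInvariant_eq_smul _ _⟩
  rw [h, Measure.smul_apply, Measure.prod_prod, hν, mul_one, ENNReal.smul_def, smul_eq_mul,
    mul_one] at hμ
  rw [h, show k = 1 by exact_mod_cast hμ, one_smul]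

end PadicIgusa

/-- The Igusa local zeta function of the `D_{2n+3}`-singularity `f(x,y) = xy² − x^{2n+2}`. -/
theorem stmt_11 (p : ℕ) [Fact p.Prime] (hp : Odd p)
    [MeasurableSpace ℚ_[p]] [BorelSpace ℚ_[p]]
    (μ : Measure (ℚ_[p] × ℚ_[p])) [μ.IsAddHaarMeasure]
    (hμ : μ ({x : ℚ_[p] | ‖x‖ ≤ 1} ×ˢ {y : ℚ_[p] | ‖y‖ ≤ 1}) = 1)
    (n : ℕ) (hn : 1 ≤ n) (s : ℝ) (hs : 0 < s) :
    (∫ z in ({x : ℚ_[p] | ‖x‖ ≤ 1} ×ˢ {y : ℚ_[p] | ‖y‖ ≤ 1}),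
        ‖z.1 * z.2 ^ 2 - z.1 ^ (2 * n + 2)‖ ^ s ∂μ)
      = ((p : ℝ) - 1) *
          ((p : ℝ) ^ ((2 * (n : ℝ) + 2) * s + (n : ℝ)) * ((p : ℝ) ^ (s + 1) - 1)
            + ((p : ℝ) - 1) * (p : ℝ) ^ ((4 * (n : ℝ) + 4) * s + 2 * (n : ℝ) + 1) *
                ((p : ℝ) ^ (s + 1) + 1)
            + ((p : ℝ) - 1) * (p : ℝ) ^ (3 * s) *
                ((p : ℝ) ^ ((2 * (n : ℝ) + 1) * s + (n : ℝ) + 1) + 1) *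
                (∑ j ∈ Finset.Icc 0 (n - 1), (p : ℝ) ^ (2 * (j : ℝ) * s + (j : ℝ)))) /
          (((p : ℝ) ^ (s + 1) - 1)
            * ((p : ℝ) ^ ((4 * (n : ℝ) + 4) * s + 2 * (n : ℝ) + 3) - 1)) := by
  have hset : {x : ℚ_[p] | ‖x‖ ≤ 1} = closedBall 0 1 := by
    ext x
    simp
  rw [hset] at hμ ⊢
  obtain ⟨ν, _, hν, rfl⟩ := PadicIgusa.exists_isAddHaarMeasure_prod_eq μ hμ
  have hP : (1 : ℝ) < p := by exact_mod_cast (Fact.out : p.Prime).one_lt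
  have hP0 : (0 : ℝ) < p := by linarith
  have hT : 1 < (p : ℝ) ^ s := Real.one_lt_rpow hP hs
  rw [setIntegral_prod _ ((PadicIgusa.continuous_norm_rpow (by fun_prop)
    hs).continuousOn.integrableOn_compact
      ((isCompact_closedBall _ _).prod (isCompact_closedBall _ _)))]
  refine (PadicIgusa.eq_of_recursion hP hT n (PadicIgusa.setIntegral_norm_rpow hν hs)
    (PadicIgusa.setIntegral_fiberIntegral hν n hs)).trans ?_
  have hmul (k : ℕ) : (p : ℝ) ^ (k * s) = ((p : ℝ) ^ s) ^ k := by
    rw [mul_comm, Real.rpow_mul hP0.le, Real.rpow_natCast]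
  have hexp (k l : ℕ) {x : ℝ} (hx : x = k * s + l) :
      (p : ℝ) ^ x = ((p : ℝ) ^ s) ^ k * (p : ℝ) ^ l := by
    rw [hx, Real.rpow_add hP0, hmul, Real.rpow_natCast]
  rw [hexp (2 * n + 2) n (x := (2 * (n : ℝ) + 2) * s + (n : ℝ)) (by push_cast; ring),
    hexp 1 1 (x := s + 1) (by push_cast; ring),
    hexp (4 * n + 4) (2 * n + 1) (x := (4 * (n : ℝ) + 4) * s + 2 * (n : ℝ) + 1) (by push_cast; ring),
    hexp 3 0 (x := 3 * s) (by push_cast; ring),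
    hexp (2 * n + 1) (n + 1) (x := (2 * (n : ℝ) + 1) * s + (n : ℝ) + 1) (by push_cast; ring),
    hexp (4 * n + 4) (2 * n + 3) (x := (4 * (n : ℝ) + 4) * s + 2 * (n : ℝ) + 3) (by push_cast; ring),
    Finset.sum_congr rfl fun j _ => hexp (2 * j) j (x := 2 * (j : ℝ) * s + j) (by push_cast; ring),
    show Finset.Icc 0 (n - 1) = Finset.range n by ext; simp; omega]
  have hsum : ∑ j ∈ Finset.range n, ((p : ℝ) ^ s) ^ (2 * j) * (p : ℝ) ^ j =
      ∑ j ∈ Finset.range n, ((p : ℝ) * ((p : ℝ) ^ s) ^ 2) ^ j :=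
    Finset.sum_congr rfl fun j _ => by rw [mul_pow, ← pow_mul, mul_comm]
  rw [hsum]
  congr 1 <;> ring
end

section
/- Let p be an odd prime, let n ≥ 1 be an integer, and let s > 0 be real. Let μ be the Haar measure on ℚ_p² normalized so that μ(ℤ_p²) = 1. Then ∫_{ℤ_p²} |x y² − x^{2n+1}|_p^s dμ(x,y) = (p−1) · [ p^{(2n+1)s+n} (p^{s+1} − 2 p^{s} + 1) + (p−1) · Σ_{j=1}^{n} p^{(2j+1)s+j−1} ] / [ (p^{(2n+1)s+n+1} − 1)(p^{s+1} − 1) ]. -/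
open MeasureTheory

namespace Padic

variable {p : ℕ} [hp : Fact p.Prime]

lemma norm_le_inv_pow_iff (x : ℚ_[p]) (k : ℕ) :
    ‖x‖ ≤ ((p : ℝ)⁻¹) ^ (k + 1) ↔ ‖x‖ < ((p : ℝ)⁻¹) ^ k := by
  have h := norm_le_pow_iff_norm_lt_pow_add_one x (-((k : ℤ) + 1))
  rw [show -((k : ℤ) + 1) + 1 = -(k : ℤ) by ring, zpow_neg, zpow_neg] at h
  rw [inv_pow, inv_pow]
  exact_mod_cast h

lemma exists_norm_eq_inv_pow {x : ℚ_[p]} (hx : x ≠ 0) (h1 : ‖x‖ ≤ 1) :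
    ∃ k : ℕ, ‖x‖ = ((p : ℝ)⁻¹) ^ k := by
  obtain ⟨k, hk⟩ := Int.eq_ofNat_of_zero_le ((norm_le_one_iff_val_nonneg x).1 h1)
  refine ⟨k, ?_⟩
  rw [norm_eq_zpow_neg_valuation hx, hk, zpow_neg, inv_pow]
  simp

lemma one_lt_cast_prime : (1 : ℝ) < p := by exact_mod_cast hp.out.one_lt

lemma inv_cast_pos : (0 : ℝ) < (p : ℝ)⁻¹ := inv_pos.2 (by exact_mod_cast hp.out.pos)

lemma inv_cast_lt_one : (p : ℝ)⁻¹ < 1 := inv_lt_one_of_one_lt₀ one_lt_cast_prime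

/-- A closed ball is the disjoint union of `p` translates of the next smaller ball. -/
lemma closedBall_eq_iUnion (k : ℕ) :
    Metric.closedBall (0 : ℚ_[p]) (((p : ℝ)⁻¹) ^ k) =
      ⋃ i : Fin p, (fun x : ℚ_[p] ↦ -((i : ℕ) * (p : ℚ_[p]) ^ k) + x) ⁻¹'
        Metric.closedBall (0 : ℚ_[p]) (((p : ℝ)⁻¹) ^ (k + 1)) := by
  have hp0 : (p : ℚ_[p]) ≠ 0 := by exact_mod_cast hp.out.ne_zero
  have hq : (0 : ℝ) < (p : ℝ)⁻¹ := inv_cast_pos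
  ext x
  simp only [Set.mem_iUnion, Set.mem_preimage, mem_closedBall_zero_iff]
  constructor
  · intro hx
    have hy : ‖x / (p : ℚ_[p]) ^ k‖ ≤ 1 := by
      rw [norm_div, norm_pow, norm_p]
      exact div_le_one_of_le₀ hx (by positivity)
    obtain ⟨i, hi, hmem⟩ := PadicInt.exists_mem_range (p := p) ⟨x / (p : ℚ_[p]) ^ k, hy⟩
    rw [PadicInt.maximalIdeal_eq_span_p, Ideal.mem_span_singleton,
      ← PadicInt.norm_lt_one_iff_dvd, PadicInt.norm_def] at hmem
    refine ⟨⟨i, hi⟩, ?_⟩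
    rw [norm_le_inv_pow_iff]
    have : -((i : ℚ_[p]) * (p : ℚ_[p]) ^ k) + x
        = (x / (p : ℚ_[p]) ^ k - i) * (p : ℚ_[p]) ^ k := by
      field_simp
      ring
    rw [this, norm_mul, norm_pow, norm_p]
    exact mul_lt_of_lt_one_left (by positivity) hmem
  · rintro ⟨i, hi⟩
    have h1 : ‖((i : ℕ) : ℚ_[p]) * (p : ℚ_[p]) ^ k‖ ≤ ((p : ℝ)⁻¹) ^ k := by
      rw [norm_mul, norm_pow, norm_p]
      exact mul_le_of_le_one_left (by positivity) (by simpa using norm_int_le_one (p := p) i)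
    have h2 := nonarchimedean (((i : ℕ) : ℚ_[p]) * (p : ℚ_[p]) ^ k)
      (-(((i : ℕ) : ℚ_[p]) * (p : ℚ_[p]) ^ k) + x)
    rw [add_neg_cancel_left] at h2
    exact h2.trans (max_le h1 (((norm_le_inv_pow_iff _ _).1 hi).le))

lemma pairwise_disjoint_translates (k : ℕ) :
    Pairwise (Function.onFun Disjoint fun i : Fin p ↦
      (fun x : ℚ_[p] ↦ -((i : ℕ) * (p : ℚ_[p]) ^ k) + x) ⁻¹'
        Metric.closedBall (0 : ℚ_[p]) (((p : ℝ)⁻¹) ^ (k + 1))) := by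
  have hq : (0 : ℝ) < (p : ℝ)⁻¹ := inv_cast_pos
  intro i j hij
  refine Set.disjoint_left.2 fun x hi hj ↦ hij ?_
  simp only [Set.mem_preimage, mem_closedBall_zero_iff, norm_le_inv_pow_iff] at hi hj
  have h := (nonarchimedean (-(((j : ℕ) : ℚ_[p]) * (p : ℚ_[p]) ^ k) + x)
    (-(-(((i : ℕ) : ℚ_[p]) * (p : ℚ_[p]) ^ k) + x))).trans_lt
      (max_lt hj (by rwa [norm_neg]))
  have he : -(((j : ℕ) : ℚ_[p]) * (p : ℚ_[p]) ^ k) + x +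
      -(-(((i : ℕ) : ℚ_[p]) * (p : ℚ_[p]) ^ k) + x)
      = (((i : ℕ) - (j : ℕ) : ℤ) : ℚ_[p]) * (p : ℚ_[p]) ^ k := by
    push_cast
    ring
  rw [he, norm_mul, norm_pow, norm_p, mul_lt_iff_lt_one_left (by positivity),
    norm_intCast_lt_one_iff] at h
  obtain ⟨c, hc⟩ := h
  have hi := i.2
  have hj := j.2
  have hc0 : c = 0 := by
    rcases lt_trichotomy c 0 with h | h | h
    · nlinarith
    · exact h
    · nlinarith
  subst hc0
  ext
  omega

lemma hasSum_of_eq {f g : ℕ → ℝ} {a b : ℝ} (h : HasSum f a) (hfg : ∀ i, g i = f i) (hab : b = a) :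
    HasSum g b := by
  rwa [funext hfg, hab]

section Measure

variable [MeasurableSpace ℚ_[p]] [BorelSpace ℚ_[p]] {ν : Measure ℚ_[p]} [ν.IsAddHaarMeasure]

lemma measureReal_closedBall (hν : ν (Metric.closedBall 0 1) = 1) (k : ℕ) :
    ν.real (Metric.closedBall 0 (((p : ℝ)⁻¹) ^ k)) = ((p : ℝ)⁻¹) ^ k := by
  have hp0 : (p : ℝ) ≠ 0 := by exact_mod_cast hp.out.ne_zero
  induction k with
  | zero => simp [Measure.real, hν]
  | succ k ih =>
    have h : ν (Metric.closedBall 0 (((p : ℝ)⁻¹) ^ k))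
        = p * ν (Metric.closedBall 0 (((p : ℝ)⁻¹) ^ (k + 1))) := by
      rw [closedBall_eq_iUnion, measure_iUnion (pairwise_disjoint_translates k)
        fun i ↦ Metric.isClosed_closedBall.measurableSet.preimage (by fun_prop)]
      simp only [measure_preimage_add, tsum_fintype, Finset.sum_const, Finset.card_univ,
        Fintype.card_fin, nsmul_eq_mul]
    have h' := congrArg ENNReal.toReal h
    rw [ENNReal.toReal_mul, ENNReal.toReal_natCast] at h'
    change ν.real _ = p * ν.real _ at h'
    rw [ih] at h'
    refine mul_left_cancel₀ hp0 (h'.symm.trans ?_)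
    rw [pow_succ]
    field_simp

lemma measureReal_sphere (hν : ν (Metric.closedBall 0 1) = 1) (k : ℕ) :
    ν.real (Metric.sphere 0 (((p : ℝ)⁻¹) ^ k)) = ((p : ℝ)⁻¹) ^ k - ((p : ℝ)⁻¹) ^ (k + 1) := by
  have h : Metric.sphere (0 : ℚ_[p]) (((p : ℝ)⁻¹) ^ k)
      = Metric.closedBall 0 (((p : ℝ)⁻¹) ^ k) \ Metric.closedBall 0 (((p : ℝ)⁻¹) ^ (k + 1)) := by
    ext x
    simp only [mem_sphere_zero_iff_norm, Set.mem_sdiff, mem_closedBall_zero_iff,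
      norm_le_inv_pow_iff, not_lt]
    exact ⟨fun h ↦ ⟨h.le, h.ge⟩, fun h ↦ le_antisymm h.1 h.2⟩
  rw [h, measureReal_sdiff _ Metric.isClosed_closedBall.measurableSet
    (isCompact_closedBall _ _).measure_lt_top.ne,
    measureReal_closedBall hν, measureReal_closedBall hν]
  exact Metric.closedBall_subset_closedBall
    (pow_le_pow_of_le_one inv_cast_pos.le inv_cast_lt_one.le (Nat.le_succ k))

/-- The integral over `ℤ_p` of a radial function is the sum of its values over the spheres. -/
lemma hasSum_setIntegral_radial (hν : ν (Metric.closedBall 0 1) = 1) {h : ℚ_[p] → ℝ} {g : ℕ → ℝ}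
    (hi : IntegrableOn h (Metric.closedBall 0 1) ν)
    (hg : ∀ (a : ℕ) (x : ℚ_[p]), ‖x‖ = ((p : ℝ)⁻¹) ^ a → h x = g a) :
    HasSum (fun a : ℕ ↦ (((p : ℝ)⁻¹) ^ a - ((p : ℝ)⁻¹) ^ (a + 1)) * g a)
      (∫ x in Metric.closedBall 0 1, h x ∂ν) := by
  have hU : (⋃ a : ℕ, Metric.sphere (0 : ℚ_[p]) (((p : ℝ)⁻¹) ^ a))
      = Metric.closedBall 0 1 \ {0} := by
    ext x
    simp only [Set.mem_iUnion, mem_sphere_zero_iff_norm, Set.mem_sdiff, mem_closedBall_zero_iff,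
      Set.mem_singleton_iff]
    constructor
    · rintro ⟨a, ha⟩
      exact ⟨ha ▸ pow_le_one₀ inv_cast_pos.le inv_cast_lt_one.le,
        norm_pos_iff.1 (ha ▸ pow_pos inv_cast_pos a)⟩
    · rintro ⟨h1, h0⟩
      exact exists_norm_eq_inv_pow h0 h1
  have hae : (⋃ a : ℕ, Metric.sphere (0 : ℚ_[p]) (((p : ℝ)⁻¹) ^ a))
      =ᵐ[ν] Metric.closedBall (0 : ℚ_[p]) 1 := by
    rw [hU]
    exact sdiff_null_ae_eq_self (measure_singleton 0)
  have hs := hasSum_integral_iUnion (μ := ν) (f := h)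
    (s := fun a : ℕ ↦ Metric.sphere (0 : ℚ_[p]) (((p : ℝ)⁻¹) ^ a))
    (fun a ↦ Metric.isClosed_sphere.measurableSet)
    (fun a b hab ↦ Set.disjoint_left.2 fun x ha hb ↦ hab <|
      (pow_right_strictAnti₀ (inv_cast_pos (p := p)) inv_cast_lt_one).injective <| by
        rw [mem_sphere_zero_iff_norm] at ha hb
        exact ha.symm.trans hb)
    (hi.mono_set (by rw [hU]; exact Set.sdiff_subset))
  rw [setIntegral_congr_set hae] at hs
  refine hasSum_of_eq hs (fun a ↦ ?_) rfl
  rw [setIntegral_congr_fun (g := fun _ ↦ g a) Metric.isClosed_sphere.measurableSet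
    (fun x hx ↦ hg a x (mem_sphere_zero_iff_norm.1 hx)), setIntegral_const,
    measureReal_sphere hν, smul_eq_mul]

lemma setIntegral_closedBall_sub_right (h : ℚ_[p] → ℝ) {u : ℚ_[p]} (hu : ‖u‖ ≤ 1) :
    ∫ y in Metric.closedBall 0 1, h (y - u) ∂ν = ∫ y in Metric.closedBall 0 1, h y ∂ν := by
  have hpre : (fun y : ℚ_[p] ↦ y - u) ⁻¹' Metric.closedBall 0 1 = Metric.closedBall 0 1 := by
    ext y
    simp only [Set.mem_preimage, mem_closedBall_zero_iff]
    constructor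
    · intro h
      simpa using (nonarchimedean (y - u) u).trans (max_le h hu)
    · intro h
      simpa [sub_eq_add_neg] using
        (nonarchimedean y (-u)).trans (max_le h (by rwa [norm_neg]))
  have := (measurePreserving_sub_right ν u).setIntegral_preimage_emb
    (MeasurableEquiv.subRight u).measurableEmbedding h (Metric.closedBall 0 1)
  rwa [hpre] at this

end Measure

/-- For odd `p`, the function `|y² - u²|^s` is a sum of translates of radial functions. -/
lemma norm_sq_sub_sq_rpow (hodd : Odd p) (s : ℝ) (y u : ℚ_[p]) :
    ‖y ^ 2 - u ^ 2‖ ^ s = (max ‖y‖ ‖u‖ ^ s) ^ 2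
      + (min ‖y - u‖ ‖u‖ ^ s * ‖u‖ ^ s - (‖u‖ ^ s) ^ 2)
      + (min ‖y - -u‖ ‖u‖ ^ s * ‖u‖ ^ s - (‖u‖ ^ s) ^ 2) := by
  have h2 : ‖(2 : ℚ_[p])‖ = 1 := by
    have := (norm_natCast_eq_one_iff (p := p) (n := 2)).2
      ((Nat.coprime_two_right.2 hodd))
    simpa using this
  have hf : ‖y ^ 2 - u ^ 2‖ ^ s = ‖y - u‖ ^ s * ‖y - -u‖ ^ s := by
    rw [← Real.mul_rpow (norm_nonneg _) (norm_nonneg _), ← norm_mul]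
    ring_nf
  rw [hf]
  have key {a b : ℚ_[p]} (h : ‖a‖ ≠ ‖b‖) : ‖a - b‖ = max ‖a‖ ‖b‖ := by
    rw [sub_eq_add_neg, add_eq_max_of_ne (by rwa [norm_neg]), norm_neg]
  rcases eq_or_ne ‖y‖ ‖u‖ with h | h
  · have ha : ‖y - u‖ ≤ ‖u‖ := by
      simpa [sub_eq_add_neg, h] using nonarchimedean y (-u)
    have hb : ‖y - -u‖ ≤ ‖u‖ := by
      simpa [h] using nonarchimedean y u
    have hc : ‖y - u‖ = ‖u‖ ∨ ‖y - -u‖ = ‖u‖ := by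
      by_contra! hne
      have h3 := nonarchimedean (y - -u) (-(y - u))
      rw [norm_neg, show y - -u + -(y - u) = 2 * u by ring, norm_mul, h2, one_mul] at h3
      exact absurd h3 (not_le.2 (max_lt (lt_of_le_of_ne hb hne.2) (lt_of_le_of_ne ha hne.1)))
    rw [min_eq_left ha, min_eq_left hb, h, max_self]
    rcases hc with hc | hc <;> rw [hc] <;> ring
  · rw [key h, key (b := -u) (by rwa [norm_neg]), norm_neg, min_eq_right (le_max_right _ _)]
    ring

lemma rpow_inv_pow (s : ℝ) (a : ℕ) : ((((p : ℝ)⁻¹) ^ a) ^ s) = (((p : ℝ)⁻¹) ^ s) ^ a := by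
  rw [← Real.rpow_natCast, ← Real.rpow_natCast, ← Real.rpow_mul inv_cast_pos.le,
    ← Real.rpow_mul inv_cast_pos.le, mul_comm]

section Integrals

variable [MeasurableSpace ℚ_[p]] [BorelSpace ℚ_[p]] {ν : Measure ℚ_[p]} [ν.IsAddHaarMeasure]

lemma setIntegral_max_rpow (hν : ν (Metric.closedBall 0 1) = 1) {s : ℝ} (hs : 0 < s) (m : ℕ) :
    ∫ y in Metric.closedBall 0 1, (max ‖y‖ (((p : ℝ)⁻¹) ^ m) ^ s) ^ 2 ∂ν
      = (1 - (p : ℝ)⁻¹) * ∑ i ∈ Finset.range m, ((p : ℝ)⁻¹ * (((p : ℝ)⁻¹) ^ s) ^ 2) ^ i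
        + ((p : ℝ)⁻¹ * (((p : ℝ)⁻¹) ^ s) ^ 2) ^ m := by
  have hq0 := inv_cast_pos (p := p)
  have hq1 := inv_cast_lt_one (p := p)
  have hc : Continuous fun y : ℚ_[p] ↦ (max ‖y‖ (((p : ℝ)⁻¹) ^ m) ^ s) ^ 2 :=
    ((continuous_norm.max continuous_const).rpow_const fun _ ↦ Or.inr hs.le).pow 2
  have h := hasSum_setIntegral_radial hν
    (g := fun a ↦ ((((p : ℝ)⁻¹) ^ min a m) ^ s) ^ 2)
    (hc.continuousOn.integrableOn_compact (isCompact_closedBall _ _))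
    (fun a x hx ↦ by
      simp only [hx]
      rw [(pow_right_strictAnti₀ hq0 hq1).antitone.map_min])
  refine h.unique ?_
  simp only [rpow_inv_pow]
  set q := (p : ℝ)⁻¹
  set t := q ^ s
  rw [← hasSum_nat_add_iff' m]
  have hg := (hasSum_geometric_of_lt_one hq0.le hq1).mul_left ((1 - q) * (q * t ^ 2) ^ m)
  refine hasSum_of_eq hg (fun i ↦ ?_) ?_
  · rw [min_eq_right (Nat.le_add_left m i)]
    ring
  · have hhead : ∑ i ∈ Finset.range m, (q ^ i - q ^ (i + 1)) * (t ^ min i m) ^ 2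
        = (1 - q) * ∑ i ∈ Finset.range m, (q * t ^ 2) ^ i := by
      rw [Finset.mul_sum]
      refine Finset.sum_congr rfl fun i hi ↦ ?_
      rw [min_eq_left (Finset.mem_range.1 hi).le]
      ring
    have : 1 - q ≠ 0 := by linarith
    rw [hhead]
    field_simp
    ring

lemma setIntegral_min_rpow (hν : ν (Metric.closedBall 0 1) = 1) {s : ℝ} (hs : 0 < s) (m : ℕ) :
    ∫ y in Metric.closedBall 0 1, (min ‖y‖ (((p : ℝ)⁻¹) ^ m) ^ s * (((p : ℝ)⁻¹) ^ m) ^ s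
        - ((((p : ℝ)⁻¹) ^ m) ^ s) ^ 2) ∂ν
      = ((p : ℝ)⁻¹ * (((p : ℝ)⁻¹) ^ s) ^ 2) ^ m
        * ((1 - (p : ℝ)⁻¹) * (1 - (p : ℝ)⁻¹ * ((p : ℝ)⁻¹) ^ s)⁻¹ - 1) := by
  have hq0 := inv_cast_pos (p := p)
  have hq1 := inv_cast_lt_one (p := p)
  have hc : Continuous fun y : ℚ_[p] ↦ (min ‖y‖ (((p : ℝ)⁻¹) ^ m) ^ s * (((p : ℝ)⁻¹) ^ m) ^ s
        - ((((p : ℝ)⁻¹) ^ m) ^ s) ^ 2) :=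
    (((continuous_norm.min continuous_const).rpow_const fun _ ↦ Or.inr hs.le).mul
      continuous_const).sub continuous_const
  have h := hasSum_setIntegral_radial hν
    (g := fun a ↦ (((p : ℝ)⁻¹) ^ max a m) ^ s * (((p : ℝ)⁻¹) ^ m) ^ s
        - ((((p : ℝ)⁻¹) ^ m) ^ s) ^ 2)
    (hc.continuousOn.integrableOn_compact (isCompact_closedBall _ _))
    (fun a x hx ↦ by
      simp only [hx]
      rw [(pow_right_strictAnti₀ hq0 hq1).antitone.map_max])
  refine h.unique ?_
  simp only [rpow_inv_pow]
  have ht0 : 0 < (p : ℝ)⁻¹ ^ s := Real.rpow_pos_of_pos hq0 s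
  have ht1 : (p : ℝ)⁻¹ ^ s < 1 := Real.rpow_lt_one hq0.le hq1 hs
  set q := (p : ℝ)⁻¹
  set t := q ^ s
  rw [← hasSum_nat_add_iff' m]
  have hqt : q * t < 1 := by nlinarith
  have hg := (((hasSum_geometric_of_lt_one (by positivity) hqt).sub
    (hasSum_geometric_of_lt_one hq0.le hq1))).mul_left ((1 - q) * (q * t ^ 2) ^ m)
  refine hasSum_of_eq hg (fun i ↦ ?_) ?_
  · rw [max_eq_left (Nat.le_add_left m i)]
    ring
  · rw [Finset.sum_eq_zero]
    · have : 1 - q ≠ 0 := by linarith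
      field_simp
      ring
    · intro i hi
      rw [max_eq_right (Finset.mem_range.1 hi).le]
      ring

lemma setIntegral_sq_sub_sq_rpow (hodd : Odd p) (hν : ν (Metric.closedBall 0 1) = 1)
    {s : ℝ} (hs : 0 < s) {m : ℕ} {u : ℚ_[p]} (hu : ‖u‖ = ((p : ℝ)⁻¹) ^ m) :
    ∫ y in Metric.closedBall 0 1, ‖y ^ 2 - u ^ 2‖ ^ s ∂ν
      = (1 - (p : ℝ)⁻¹) * ∑ i ∈ Finset.range m, ((p : ℝ)⁻¹ * (((p : ℝ)⁻¹) ^ s) ^ 2) ^ i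
        + ((p : ℝ)⁻¹ * (((p : ℝ)⁻¹) ^ s) ^ 2) ^ m
          * (2 * (1 - (p : ℝ)⁻¹) * (1 - (p : ℝ)⁻¹ * ((p : ℝ)⁻¹) ^ s)⁻¹ - 1) := by
  have hu1 : ‖u‖ ≤ 1 := hu ▸ pow_le_one₀ inv_cast_pos.le inv_cast_lt_one.le
  simp only [norm_sq_sub_sq_rpow hodd]
  have hcA : Continuous fun y : ℚ_[p] ↦ (max ‖y‖ ‖u‖ ^ s) ^ 2 :=
    ((continuous_norm.max continuous_const).rpow_const fun _ ↦ Or.inr hs.le).pow 2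
  have hcB (v : ℚ_[p]) : Continuous fun y : ℚ_[p] ↦
      (min ‖y - v‖ ‖u‖ ^ s * ‖u‖ ^ s - (‖u‖ ^ s) ^ 2) :=
    ((((continuous_id.sub continuous_const).norm.min continuous_const).rpow_const
      fun _ ↦ Or.inr hs.le).mul continuous_const).sub continuous_const
  have hK := isCompact_closedBall (0 : ℚ_[p]) 1
  have hiA := hcA.continuousOn.integrableOn_compact (μ := ν) hK
  have hiB v := (hcB v).continuousOn.integrableOn_compact (μ := ν) hK
  rw [integral_add (by exact hiA.add (hiB u)) (hiB (-u)), integral_add hiA (hiB u),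
    setIntegral_closedBall_sub_right
      (fun z ↦ min ‖z‖ ‖u‖ ^ s * ‖u‖ ^ s - (‖u‖ ^ s) ^ 2) hu1,
    setIntegral_closedBall_sub_right
      (fun z ↦ min ‖z‖ ‖u‖ ^ s * ‖u‖ ^ s - (‖u‖ ^ s) ^ 2) (u := -u) (by rwa [norm_neg]),
    hu, setIntegral_max_rpow hν hs, setIntegral_min_rpow hν hs]
  ring

/-- The Igusa zeta function of `xy² - x^(2n+1)` as a rational function of `q = p⁻¹`
and `t = p⁻ˢ`. -/
lemma setIntegral_igusa (hodd : Odd p) (hν : ν (Metric.closedBall 0 1) = 1)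
    {s : ℝ} (hs : 0 < s) (n : ℕ) :
    ∫ z in Metric.closedBall (0 : ℚ_[p]) 1 ×ˢ Metric.closedBall (0 : ℚ_[p]) 1,
        ‖z.1 * z.2 ^ 2 - z.1 ^ (2 * n + 1)‖ ^ s ∂(ν.prod ν)
      = (1 - (p : ℝ)⁻¹) * ((1 - (p : ℝ)⁻¹) * (1 - (p : ℝ)⁻¹ * (((p : ℝ)⁻¹) ^ s) ^ 2)⁻¹
          * ((1 - (p : ℝ)⁻¹ * ((p : ℝ)⁻¹) ^ s)⁻¹
            - (1 - (p : ℝ)⁻¹ * ((p : ℝ)⁻¹) ^ s * ((p : ℝ)⁻¹ * (((p : ℝ)⁻¹) ^ s) ^ 2) ^ n)⁻¹)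
        + (2 * (1 - (p : ℝ)⁻¹) * (1 - (p : ℝ)⁻¹ * ((p : ℝ)⁻¹) ^ s)⁻¹ - 1)
          * (1 - (p : ℝ)⁻¹ * ((p : ℝ)⁻¹) ^ s * ((p : ℝ)⁻¹ * (((p : ℝ)⁻¹) ^ s) ^ 2) ^ n)⁻¹) := by
  have hq0 := inv_cast_pos (p := p)
  have hq1 := inv_cast_lt_one (p := p)
  have hK := isCompact_closedBall (0 : ℚ_[p]) 1
  have hc : Continuous fun z : ℚ_[p] × ℚ_[p] ↦ ‖z.1 * z.2 ^ 2 - z.1 ^ (2 * n + 1)‖ ^ s :=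
    Continuous.rpow_const (by fun_prop) fun _ ↦ Or.inr hs.le
  have hi := hc.continuousOn.integrableOn_compact (μ := ν.prod ν) (hK.prod hK)
  rw [setIntegral_prod _ hi]
  have hi' := hi
  rw [IntegrableOn, ← Measure.prod_restrict] at hi'
  refine (hasSum_setIntegral_radial hν
    (g := fun a ↦ (((p : ℝ)⁻¹) ^ s) ^ a * ((1 - (p : ℝ)⁻¹)
        * ∑ i ∈ Finset.range (a * n), ((p : ℝ)⁻¹ * (((p : ℝ)⁻¹) ^ s) ^ 2) ^ i
        + ((p : ℝ)⁻¹ * (((p : ℝ)⁻¹) ^ s) ^ 2) ^ (a * n)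
          * (2 * (1 - (p : ℝ)⁻¹) * (1 - (p : ℝ)⁻¹ * ((p : ℝ)⁻¹) ^ s)⁻¹ - 1)))
    hi'.integral_prod_left (fun a x hx ↦ ?_)).unique ?_
  · have hf (y : ℚ_[p]) : ‖x * y ^ 2 - x ^ (2 * n + 1)‖ ^ s
        = ‖x‖ ^ s * ‖y ^ 2 - (x ^ n) ^ 2‖ ^ s := by
      rw [← Real.mul_rpow (norm_nonneg _) (norm_nonneg _), ← norm_mul]
      ring_nf
    simp only [hf]
    rw [integral_const_mul, setIntegral_sq_sub_sq_rpow hodd hν hs (m := a * n)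
      (by rw [norm_pow, hx, pow_mul]), hx, rpow_inv_pow]
  · have ht0 : 0 < (p : ℝ)⁻¹ ^ s := Real.rpow_pos_of_pos hq0 s
    have ht1 : (p : ℝ)⁻¹ ^ s < 1 := Real.rpow_lt_one hq0.le hq1 hs
    set q := (p : ℝ)⁻¹
    set t := q ^ s
    have hqt : q * t < 1 := by nlinarith
    have hw0 : 0 < q * t ^ 2 := by positivity
    have hw : q * t ^ 2 < 1 := by nlinarith
    have hr : q * t * (q * t ^ 2) ^ n < 1 :=
      mul_lt_one_of_nonneg_of_lt_one_left (by positivity) hqt (pow_le_one₀ hw0.le hw.le)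
    have h1 := hasSum_geometric_of_lt_one (by positivity) hqt
    have h2 := hasSum_geometric_of_lt_one (by positivity) hr
    refine hasSum_of_eq ((((h1.sub h2).mul_left ((1 - q) * (1 - q * t ^ 2)⁻¹)).add
      (h2.mul_left (2 * (1 - q) * (1 - q * t)⁻¹ - 1))).mul_left (1 - q)) (fun a ↦ ?_) rfl
    rw [geom_sum_eq hw.ne, mul_pow _ ((q * t ^ 2) ^ n), ← pow_mul, mul_comm n a]
    generalize (q * t ^ 2) ^ (a * n) = W
    have e1 : q * t ^ 2 - 1 ≠ 0 := by linarith
    have e2 : 1 - q * t ^ 2 ≠ 0 := by linarith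
    have e3 : (W - 1) / (q * t ^ 2 - 1) = (1 - W) * (1 - q * t ^ 2)⁻¹ := by
      field_simp
      ring
    rw [e3]
    ring

end Integrals

/-- An additive Haar measure on `ℚ_p²` giving `ℤ_p²` mass one is a product measure. -/
lemma exists_eq_prod [MeasurableSpace ℚ_[p]] [BorelSpace ℚ_[p]]
    (μ : Measure (ℚ_[p] × ℚ_[p])) [μ.IsAddHaarMeasure]
    (hμ : μ (Metric.closedBall 0 1 ×ˢ Metric.closedBall 0 1) = 1) :
    ∃ ν : Measure ℚ_[p], ν.IsAddHaarMeasure ∧ ν (Metric.closedBall 0 1) = 1 ∧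
      μ = ν.prod ν := by
  let K : TopologicalSpace.PositiveCompacts ℚ_[p] :=
    { carrier := Metric.closedBall 0 1
      isCompact' := isCompact_closedBall _ _
      interior_nonempty' :=
        ⟨0, mem_interior_iff_mem_nhds.2 (Metric.closedBall_mem_nhds _ one_pos)⟩ }
  have hK : Measure.addHaarMeasure K (Metric.closedBall 0 1) = 1 := Measure.addHaarMeasure_self
  refine ⟨Measure.addHaarMeasure K, inferInstance, hK, ?_⟩
  have h := Measure.isAddLeftInvariant_eq_smul μ
    ((Measure.addHaarMeasure K).prod (Measure.addHaarMeasure K))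
  rw [h, Measure.smul_apply, Measure.prod_prod, hK, one_mul] at hμ
  rw [h]
  have hc : Measure.addHaarScalarFactor μ
      ((Measure.addHaarMeasure K).prod (Measure.addHaarMeasure K)) = 1 := by
    simpa [ENNReal.smul_def] using hμ
  rw [hc, one_smul]

end Padic

/-- The Igusa local zeta function of the `D_{2n+2}`-singularity `f(x,y) = xy² − x^{2n+1}`. -/
theorem stmt_13 (p : ℕ) [Fact p.Prime] (hp : Odd p)
    [MeasurableSpace ℚ_[p]] [BorelSpace ℚ_[p]]
    (μ : Measure (ℚ_[p] × ℚ_[p])) [μ.IsAddHaarMeasure]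
    (hμ : μ ({x : ℚ_[p] | ‖x‖ ≤ 1} ×ˢ {y : ℚ_[p] | ‖y‖ ≤ 1}) = 1)
    (n : ℕ) (hn : 1 ≤ n) (s : ℝ) (hs : 0 < s) :
    (∫ z in ({x : ℚ_[p] | ‖x‖ ≤ 1} ×ˢ {y : ℚ_[p] | ‖y‖ ≤ 1}),
        ‖z.1 * z.2 ^ 2 - z.1 ^ (2 * n + 1)‖ ^ s ∂μ)
      = ((p : ℝ) - 1) *
          ((p : ℝ) ^ ((2 * (n : ℝ) + 1) * s + (n : ℝ)) *
              ((p : ℝ) ^ (s + 1) - 2 * (p : ℝ) ^ s + 1)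
            + ((p : ℝ) - 1) *
                (∑ j ∈ Finset.Icc 1 n,
                  (p : ℝ) ^ ((2 * (j : ℝ) + 1) * s + (j : ℝ) - 1))) /
          (((p : ℝ) ^ ((2 * (n : ℝ) + 1) * s + (n : ℝ) + 1) - 1)
            * ((p : ℝ) ^ (s + 1) - 1)) := by
  have hball : {x : ℚ_[p] | ‖x‖ ≤ 1} = Metric.closedBall 0 1 := by
    ext x
    simp
  rw [hball] at hμ ⊢
  obtain ⟨ν, hν, hν1, rfl⟩ := Padic.exists_eq_prod μ hμ
  rw [Padic.setIntegral_igusa hp hν1 hs n]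
  have hp1 : (1 : ℝ) < p := Padic.one_lt_cast_prime
  have hp0 : (0 : ℝ) < p := by linarith
  have hT1 : 1 < (p : ℝ) ^ s := Real.one_lt_rpow hp1 hs
  have hpow (k : ℕ) : (p : ℝ) ^ ((2 * (k : ℝ) + 1) * s + (k : ℝ))
      = (p * ((p : ℝ) ^ s) ^ 2) ^ k * (p : ℝ) ^ s := by
    rw [Real.rpow_add hp0, mul_comm _ s, Real.rpow_mul hp0.le, Real.rpow_natCast,
      show (2 * (k : ℝ) + 1) = ((2 * k + 1 : ℕ) : ℝ) by push_cast; ring, Real.rpow_natCast]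
    ring
  have hsum : ∑ j ∈ Finset.Icc 1 n, (p : ℝ) ^ ((2 * (j : ℝ) + 1) * s + (j : ℝ) - 1)
      = ((p : ℝ) ^ s) ^ 3
        * (((p * ((p : ℝ) ^ s) ^ 2) ^ n - 1) / (p * ((p : ℝ) ^ s) ^ 2 - 1)) := by
    rw [← geom_sum_eq (by nlinarith), Finset.mul_sum, show Finset.Icc 1 n = Finset.Ico (0 + 1) (n + 1)
      from rfl, ← Finset.sum_Ico_add', ← Finset.range_eq_Ico]
    refine Finset.sum_congr rfl fun i _ ↦ ?_
    rw [Real.rpow_sub_one hp0.ne', hpow]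
    field_simp
    ring
  rw [hsum, Real.rpow_add hp0 s 1, Real.rpow_add hp0 _ 1, hpow, Real.rpow_one,
    Real.inv_rpow hp0.le]
  generalize (p : ℝ) ^ s = T at *
  have hT0 : 0 < T := by linarith
  have hA : 1 ≤ (p * T ^ 2) ^ n := one_le_pow₀ (by nlinarith)
  have hinv : ((p : ℝ)⁻¹ * T⁻¹ ^ 2) ^ n = ((p * T ^ 2) ^ n)⁻¹ := by
    rw [← inv_pow, mul_inv, inv_pow]
  rw [hinv]
  generalize (p * T ^ 2) ^ n = A at *
  generalize (p : ℝ) = P at *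
  have hA0 : 0 < A := by linarith
  have hPT : 1 < P * T := by nlinarith
  have e1 : P * T - 1 ≠ 0 := by linarith
  have e2 : P * T ^ 2 - 1 ≠ 0 := by nlinarith
  have e3 : P * T * A - 1 ≠ 0 := by nlinarith
  have i1 : (1 - P⁻¹ * T⁻¹)⁻¹ = P * T / (P * T - 1) := by
    rw [inv_eq_iff_eq_inv, inv_div]
    field_simp
  have i2 : (1 - P⁻¹ * T⁻¹ ^ 2)⁻¹ = P * T ^ 2 / (P * T ^ 2 - 1) := by
    rw [inv_eq_iff_eq_inv, inv_div]
    field_simp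
  have i3 : (1 - P⁻¹ * T⁻¹ * A⁻¹)⁻¹ = P * T * A / (P * T * A - 1) := by
    rw [inv_eq_iff_eq_inv, inv_div]
    field_simp
  rw [i1, i2, i3]
  field_simp
  ring
end
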